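/- arXiv:2001.04857 — 3 statements merged into one kernel-verified Lean document; each statement's English description precedes it below -/
import Mathlib

section
/- Let X be a connected uniformly locally finite graph and T ≤ X a leafless end-defining subtree. Then Z^suf_1(X,ℤ₂) is the internal direct sum of Z^suf_1(T,ℤ₂) and 𝒞(X,ℤ₂): these two subspaces of the ℤ₂-vector space Z^suf_1(X,ℤ₂) intersect trivially and together span it. Consequently Z^suf_1(X,ℤ₂)/𝒞_∞(X,ℤ₂) is isomorphic to Z^suf_1(T,ℤ₂) ⊕ (𝒞(X,ℤ₂)/𝒞_∞(X,ℤ₂)); i.e., H^uf_1(X,ℤ₂) ≅ H^uf_1(T,ℤ₂) ⊕ 𝒞(X,ℤ₂)/𝒞_∞(X,ℤ₂). -/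
open scoped Classical

namespace UFH

variable {V : Type}

/-- Uniform local finiteness: a uniform bound on vertex degrees. -/
def ULF (G : SimpleGraph V) : Prop :=
  ∃ D : ℕ, ∀ v : V, (G.neighborSet v).Finite ∧ (G.neighborSet v).ncard ≤ D

/-- An integer 1-chain: antisymmetric and supported on adjacent pairs. -/
def IsChain1 (G : SimpleGraph V) (f : V → V → ℤ) : Prop :=
  (∀ u v, f u v = - f v u) ∧ ∀ u v, f u v ≠ 0 → G.Adj u v

/-- A mod-2 1-chain: symmetric and supported on adjacent pairs. -/
def IsChain1Z2 (G : SimpleGraph V) (f : V → V → ZMod 2) : Prop :=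
  (∀ u v, f u v = f v u) ∧ ∀ u v, f u v ≠ 0 → G.Adj u v

/-- Divergence of an integer 1-chain at a vertex. -/
noncomputable def chainDiv (f : V → V → ℤ) (v : V) : ℤ := ∑ᶠ u, f u v

/-- Divergence of a mod-2 1-chain at a vertex. -/
noncomputable def chainDivZ2 (f : V → V → ZMod 2) (v : V) : ZMod 2 := ∑ᶠ u, f u v

def Bdd (f : V → V → ℤ) (C : ℕ) : Prop := ∀ u v, |f u v| ≤ (C : ℤ)

/-- The sup-norm of a bounded integer 1-chain (least uniform bound). -/
noncomputable def chainNorm (f : V → V → ℤ) : ℕ := sInf {C : ℕ | Bdd f C}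

/-- Bounded integer flows: bounded 1-chains with vanishing divergence everywhere. -/
def Zsuf1 (G : SimpleGraph V) : Set (V → V → ℤ) :=
  {f | IsChain1 G f ∧ (∃ C, Bdd f C) ∧ ∀ v, chainDiv f v = 0}

/-- Mod-2 cycles: mod-2 1-chains whose support meets every vertex evenly. -/
def Zsuf1Z2 (G : SimpleGraph V) : Set (V → V → ZMod 2) :=
  {f | IsChain1Z2 G f ∧ ∀ v, chainDivZ2 f v = 0}

/-- A circuit: a closed walk (based at some vertex). -/
abbrev Circuit (G : SimpleGraph V) := Σ v : V, G.Walk v v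

/-- Number of traversals of the oriented edge `(a, b)` by the walk `p`. -/
noncomputable def traversals {G : SimpleGraph V} {u v : V} (p : G.Walk u v) (a b : V) : ℕ :=
  ((Finset.range p.length).filter fun i => p.getVert i = a ∧ p.getVert (i + 1) = b).card

/-- The integer 1-chain of signed traversals of a walk. -/
noncomputable def walkChain {G : SimpleGraph V} {u v : V} (p : G.Walk u v) (a b : V) : ℤ :=
  (traversals p a b : ℤ) - (traversals p b a : ℤ)

/-- The mod-2 1-chain of traversals of a walk. -/
noncomputable def walkChainZ2 {G : SimpleGraph V} {u v : V} (p : G.Walk u v) (a b : V) : ZMod 2 :=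
  (traversals p a b : ZMod 2) + (traversals p b a : ZMod 2)

/-- The walk `p` passes through the edge `{a, b}`. -/
def OnWalk {G : SimpleGraph V} {u v : V} (p : G.Walk u v) (a b : V) : Prop :=
  ∃ i < p.length, (p.getVert i = a ∧ p.getVert (i + 1) = b) ∨
    (p.getVert i = b ∧ p.getVert (i + 1) = a)

/-- A coefficient family on circuits is thin (locally finite). -/
def ThinCoef (G : SimpleGraph V) (g : Circuit G → ℤ) : Prop :=
  ∀ a b : V, {c : Circuit G | g c ≠ 0 ∧ OnWalk c.2 a b}.Finite

def ThinCoefZ2 (G : SimpleGraph V) (g : Circuit G → ZMod 2) : Prop :=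
  ∀ a b : V, {c : Circuit G | g c ≠ 0 ∧ OnWalk c.2 a b}.Finite

/-- The 1-chain obtained as the (pointwise) sum of a family of circuits with coefficients. -/
noncomputable def circSum (G : SimpleGraph V) (g : Circuit G → ℤ) : V → V → ℤ :=
  fun a b => ∑ᶠ c : Circuit G, g c * walkChain c.2 a b

noncomputable def circSumZ2 (G : SimpleGraph V) (g : Circuit G → ZMod 2) : V → V → ZMod 2 :=
  fun a b => ∑ᶠ c : Circuit G, g c * walkChainZ2 c.2 a b

/-- 𝒞_r(X, ℤ): sums of circuits of length ≤ r with uniformly bounded integer coefficients. -/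
def Cr (G : SimpleGraph V) (r : ℕ) : Set (V → V → ℤ) :=
  {f | ∃ g : Circuit G → ℤ, (∃ C : ℕ, ∀ c, |g c| ≤ (C : ℤ)) ∧
    (∀ c, g c ≠ 0 → c.2.length ≤ r) ∧ ThinCoef G g ∧ f = circSum G g}

/-- 𝒞_∞(X, ℤ). -/
def Cinf (G : SimpleGraph V) : Set (V → V → ℤ) := ⋃ r : ℕ, Cr G r

/-- 𝒞(X, ℤ): thin sums of circuits with integer coefficients whose result is bounded. -/
def Cthin (G : SimpleGraph V) : Set (V → V → ℤ) :=
  {f | ∃ g : Circuit G → ℤ, ThinCoef G g ∧ (∃ C, Bdd f C) ∧ f = circSum G g}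

/-- 𝒞_r(X, ℤ₂). -/
def CrZ2 (G : SimpleGraph V) (r : ℕ) : Set (V → V → ZMod 2) :=
  {f | ∃ g : Circuit G → ZMod 2, (∀ c, g c ≠ 0 → c.2.length ≤ r) ∧
    ThinCoefZ2 G g ∧ f = circSumZ2 G g}

/-- 𝒞_∞(X, ℤ₂). -/
def CinfZ2 (G : SimpleGraph V) : Set (V → V → ZMod 2) := ⋃ r : ℕ, CrZ2 G r

/-- 𝒞(X, ℤ₂): thin sums of circuits mod 2. -/
def CthinZ2 (G : SimpleGraph V) : Set (V → V → ZMod 2) :=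
  {f | ∃ g : Circuit G → ZMod 2, ThinCoefZ2 G g ∧ f = circSumZ2 G g}

/-- `a` and `b` are joined by a walk avoiding the set `K`. -/
def ConnAvoiding (G : SimpleGraph V) (K : Set V) (a b : V) : Prop :=
  ∃ p : G.Walk a b, ∀ v ∈ p.support, v ∉ K

/-- A (one-sided infinite) ray in `G`. -/
def IsRay (G : SimpleGraph V) (x : ℕ → V) : Prop :=
  Function.Injective x ∧ ∀ n, G.Adj (x n) (x (n + 1))

/-- Two rays determine the same end. -/
def RayEquiv (G : SimpleGraph V) (x y : ℕ → V) : Prop :=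
  ∀ K : Finset V, ∃ N, ∀ n, N ≤ n → ∀ m, N ≤ m → ConnAvoiding G (↑K) (x n) (y m)

/-- The connected component of `v` in `X − K`. -/
def Component (G : SimpleGraph V) (K : Set V) (v : V) : Set V :=
  {u | u ∉ K ∧ ConnAvoiding G K u v}

def MoreThanOneEnd (G : SimpleGraph V) : Prop :=
  ∃ K : Finset V, ∃ v w : V, v ∉ K ∧ w ∉ K ∧ (Component G (↑K) v).Infinite ∧
    (Component G (↑K) w).Infinite ∧ ¬ ConnAvoiding G (↑K) v w

def OneEnded (G : SimpleGraph V) : Prop :=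
  Infinite V ∧ ∀ K : Finset V, ∃ v, v ∉ K ∧ (Component G (↑K) v).Infinite ∧
    ∀ u, u ∉ K → (Component G (↑K) u).Infinite → ConnAvoiding G (↑K) u v

/-- A bip: a bi-infinite path, i.e. injective graph morphism ℤ → T. -/
def IsBip (T : SimpleGraph V) (b : ℤ → V) : Prop :=
  Function.Injective b ∧ ∀ n : ℤ, T.Adj (b n) (b (n + 1))

/-- The bip `b` lies over the edge `{u, v}`. -/
def LiesOver (b : ℤ → V) (u v : V) : Prop :=
  ∃ n : ℤ, (b n = u ∧ b (n + 1) = v) ∨ (b n = v ∧ b (n + 1) = u)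

/-- The signed traversal of the oriented edge `(u, v)` by the bip `b`. -/
noncomputable def bipSign (b : ℤ → V) (u v : V) : ℤ :=
  if ∃ n : ℤ, b n = u ∧ b (n + 1) = v then 1
  else if ∃ n : ℤ, b n = v ∧ b (n + 1) = u then -1 else 0

noncomputable def bipOverZ2 (b : ℤ → V) (u v : V) : ZMod 2 :=
  if LiesOver b u v then 1 else 0

/-- `p` is the last bip of `P` (w.r.t. the order `r`) lying over the edge `{u, v}`. -/
def IsLast (P : Set (ℤ → V)) (r : (ℤ → V) → (ℤ → V) → Prop) (p : ℤ → V) (u v : V) : Prop :=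
  LiesOver p u v ∧ ∀ q ∈ P, q ≠ p → LiesOver q u v → r q p

/-- The 1-chain associated to coefficients on a family of bips. -/
noncomputable def bipMap (P : Set (ℤ → V)) (f : ↥P → ℤ) : V → V → ℤ :=
  fun u v => ∑ᶠ p : ↥P, f p * bipSign p.1 u v

noncomputable def bipMapZ2 (P : Set (ℤ → V)) (f : ↥P → ZMod 2) : V → V → ZMod 2 :=
  fun u v => ∑ᶠ p : ↥P, f p * bipOverZ2 p.1 u v

/-- The set `S` is connected in the graph `H` (walks staying inside `S`). -/
def ConnectedIn (H : SimpleGraph V) (S : Set V) : Prop :=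
  ∀ a ∈ S, ∀ b ∈ S, ∃ p : H.Walk a b, ∀ v ∈ p.support, v ∈ S

/-- `T` is a subtree of `G`. -/
def IsSubtree (G T : SimpleGraph V) : Prop :=
  T ≤ G ∧ T.IsAcyclic ∧ T.support.Nonempty ∧ ConnectedIn T T.support

/-- Every vertex of `T` has degree ≥ 2 in `T`. -/
def Leafless (T : SimpleGraph V) : Prop :=
  ∀ v ∈ T.support, ∃ u w : V, u ≠ w ∧ T.Adj v u ∧ T.Adj v w

/-- Distinct ends of `T` determine distinct ends of `G`. -/
def EndRespecting (G T : SimpleGraph V) : Prop :=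
  ∀ x y : ℕ → V, IsRay T x → IsRay T y → RayEquiv G x y → RayEquiv T x y

/-- Every end of `G` is represented by a unique end of `T`. -/
def EndDefining (G T : SimpleGraph V) : Prop :=
  EndRespecting G T ∧ ∀ x : ℕ → V, IsRay G x → ∃ y : ℕ → V, IsRay T y ∧ RayEquiv G x y

/-- The subtree `T` of `G` has separators. -/
def HasSeparators (G T : SimpleGraph V) : Prop :=
  ∃ K : ℕ → Finset V,
    (∀ n, K n ⊆ K (n + 1)) ∧
    (∀ v : V, ∃ n, v ∈ K n) ∧
    (∀ n, ConnectedIn G (↑(K n))) ∧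
    (∀ n, ConnectedIn T (T.support ∩ ↑(K n))) ∧
    (∀ n, ∀ v : V, v ∉ K n → (Component G (↑(K n)) v).Infinite →
      ∃! e : V × V, T.Adj e.1 e.2 ∧ e.1 ∈ K n ∧ e.2 ∉ K n ∧
        e.2 ∈ Component G (↑(K n)) v) ∧
    (∀ n, ∀ a b : V, T.Adj a b → a ∈ K n → b ∉ K n → (Component G (↑(K n)) b).Infinite)

/-- An integer 2-chain: alternating, supported on triangles. -/
def IsChain2 (G : SimpleGraph V) (g : V → V → V → ℤ) : Prop :=
  (∀ u v w, g u v w = - g v u w) ∧ (∀ u v w, g u v w = - g u w v) ∧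
    ∀ u v w, g u v w ≠ 0 → G.Adj u v ∧ G.Adj v w ∧ G.Adj u w

def Bdd2 (g : V → V → V → ℤ) (C : ℕ) : Prop := ∀ u v w, |g u v w| ≤ (C : ℤ)

/-- The boundary of a 2-chain. -/
noncomputable def bd2 (g : V → V → V → ℤ) : V → V → ℤ := fun u v => ∑ᶠ w, g u v w

/-- `H^suf_1`-expansion. -/
def HsufExp1 (G : SimpleGraph V) : Prop :=
  ∃ K : ℕ → ℕ, ∀ U : Finset V, ∀ f : V → V → ℤ,
    IsChain1 G f →
    (∀ u v, f u v ≠ 0 → u ∈ U ∧ v ∈ U) →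
    (∀ v ∈ U, (∀ u, G.Adj u v → u ∈ U) → chainDiv f v = 0) →
    (∃ fh ∈ Zsuf1 G, (∀ u ∈ U, ∀ v ∈ U, fh u v = f u v) ∧ chainNorm fh = chainNorm f) →
    ∃ g : V → V → V → ℤ, IsChain2 G g ∧ Bdd2 g (K (chainNorm f)) ∧
      ∀ u ∈ U, ∀ v ∈ U, bd2 g u v = f u v

/-- Pure `H^suf_1`-expansion. -/
def PureHsufExp1 (G : SimpleGraph V) : Prop :=
  ∃ K : ℕ → ℕ, ∀ U : Finset V, ∀ f : V → V → ℤ,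
    IsChain1 G f →
    (∀ u v, f u v ≠ 0 → u ∈ U ∧ v ∈ U) →
    (∀ v ∈ U, (∀ u, G.Adj u v → u ∈ U) → chainDiv f v = 0) →
    (∃ fh : V → V → ℤ, IsChain1 G fh ∧
        (∃ g2 : V → V → V → ℤ, IsChain2 G g2 ∧ (∃ C, Bdd2 g2 C) ∧ bd2 g2 = fh) ∧
        (∀ u ∈ U, ∀ v ∈ U, fh u v = f u v) ∧ chainNorm fh = chainNorm f) →
    ∃ g : V → V → V → ℤ, IsChain2 G g ∧ Bdd2 g (K (chainNorm f)) ∧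
      ∀ u ∈ U, ∀ v ∈ U, bd2 g u v = f u v

/-- The Rips graph of radius `s`. -/
def rips (G : SimpleGraph V) (s : ℕ) : SimpleGraph V :=
  SimpleGraph.fromRel fun u v => G.dist u v ≤ s

/-- Pure `H^uf_1`-expansion: the Rips graphs eventually have pure `H^suf_1`-expansion. -/
def PureHufExp1 (G : SimpleGraph V) : Prop := ∃ s₀ : ℕ, ∀ s, s₀ ≤ s → PureHsufExp1 (rips G s)

def VertexTransitive (G : SimpleGraph V) : Prop := ∀ u v : V, ∃ φ : G ≃g G, φ u = v

/-- The edge boundary of a finite set of vertices. -/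
def edgeBoundary (G : SimpleGraph V) (U : Finset V) : Set (Sym2 V) :=
  {e | e ∈ G.edgeSet ∧ ∃ a b : V, e = s(a, b) ∧ a ∈ U ∧ b ∉ U}

/-- Mod-2 reduction of an integer 1-chain. -/
def mod2 (f : V → V → ℤ) : V → V → ZMod 2 := fun u v => ((f u v : ℤ) : ZMod 2)

/-- Pointwise domination of 1-chains: `r` flows in the same direction as `φ`, no stronger. -/
def chainLE (r φ : V → V → ℤ) : Prop :=
  ∀ u v, (0 ≤ φ u v → 0 ≤ r u v ∧ r u v ≤ φ u v) ∧ (φ u v ≤ 0 → φ u v ≤ r u v ∧ r u v ≤ 0)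

/-- A set of functions is locally finite (thin). -/
def ThinFamily {Y : Type} (F : Set (Y → ZMod 2)) : Prop := ∀ y : Y, {f ∈ F | f y ≠ 0}.Finite

/-- The pointwise sum of a (thin) set of functions. -/
noncomputable def thinSum {Y : Type} (F : Set (Y → ZMod 2)) : Y → ZMod 2 :=
  fun y => ∑ᶠ f : ↥F, f.1 y

/-- A thin-sum space: a subspace closed under thin sums. -/
def IsThinSumSpace {Y : Type} (W : Set (Y → ZMod 2)) : Prop :=
  0 ∈ W ∧ (∀ f ∈ W, ∀ g ∈ W, f + g ∈ W) ∧ ∀ F ⊆ W, ThinFamily F → thinSum F ∈ W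

/-- A thin-sum basis for a thin-sum space. -/
def IsThinSumBasis {Y : Type} (A W : Set (Y → ZMod 2)) : Prop :=
  A ⊆ W ∧ (∀ f ∈ W, ∃ F ⊆ A, ThinFamily F ∧ f = thinSum F) ∧
    ∀ F ⊆ A, ThinFamily F → F.Nonempty → thinSum F ≠ 0

lemma zmod_two_eq_one {x : ZMod 2} (hx : x ≠ 0) : x = 1 := Fin.eq_one_of_ne_zero x hx

/-- The mod-2 coboundary of a function on the vertices. -/
def cob (φ : V → ZMod 2) : Sym2 V → ZMod 2 :=
  Sym2.lift ⟨fun a b => φ a + φ b, fun _ _ => add_comm _ _⟩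

@[simp] lemma cob_mk (φ : V → ZMod 2) (a b : V) : cob φ s(a, b) = φ a + φ b := rfl

lemma cob_add (φ ψ : V → ZMod 2) (e : Sym2 V) : cob (φ + ψ) e = cob φ e + cob ψ e := by
  induction e with | _ a b => simp; ring

lemma cob_sum {ι : Type*} (s : Finset ι) (φ : ι → V → ZMod 2) (e : Sym2 V) :
    cob (∑ i ∈ s, φ i) e = ∑ i ∈ s, cob (φ i) e := by
  induction e with | _ a b => simp [Finset.sum_add_distrib]

lemma cob_const (c : ZMod 2) (e : Sym2 V) : cob (fun _ => c) e = 0 := by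
  induction e with | _ a b => simp [CharTwo.add_self_eq_zero]

/-- `h` vanishes outside the edges of `G`. -/
def SupportedOn (G : SimpleGraph V) (h : Sym2 V → ZMod 2) : Prop :=
  ∀ e, h e ≠ 0 → e ∈ G.edgeSet

/-- `φ` changes along only finitely many edges of `G`; equivalently, it is the indicator of one
side of a finite cut. -/
def FiniteCob (G : SimpleGraph V) (φ : V → ZMod 2) : Prop :=
  {e ∈ G.edgeSet | cob φ e ≠ 0}.Finite

/-- The value of the mod-2 chain `h` on the cut determined by `φ`. -/
noncomputable def cutValue (h : Sym2 V → ZMod 2) (φ : V → ZMod 2) : ZMod 2 :=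
  ∑ᶠ e, h e * cob φ e

section cuts

variable {G : SimpleGraph V} {h : Sym2 V → ZMod 2}

lemma FiniteCob.support_finite {φ : V → ZMod 2} (hφ : FiniteCob G φ) (hh : SupportedOn G h) :
    (Function.support fun e => h e * cob φ e).Finite :=
  hφ.subset fun e he => ⟨hh e (left_ne_zero_of_mul he), right_ne_zero_of_mul he⟩

lemma FiniteCob.add {φ ψ : V → ZMod 2} (hφ : FiniteCob G φ) (hψ : FiniteCob G ψ) :
    FiniteCob G (φ + ψ) := by
  refine (hφ.union hψ).subset fun e ⟨he, hne⟩ => ?_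
  by_contra hcon
  simp only [Set.mem_union, Set.mem_ofPred_eq, he, true_and, not_or, not_not] at hcon
  exact hne (by rw [cob_add, hcon.1, hcon.2, add_zero])

lemma finiteCob_const (c : ZMod 2) : FiniteCob G fun _ => c := by
  simp [FiniteCob, cob_const]

lemma FiniteCob.sum {ι : Type*} (s : Finset ι) {φ : ι → V → ZMod 2}
    (hφ : ∀ i ∈ s, FiniteCob G (φ i)) : FiniteCob G (∑ i ∈ s, φ i) := by
  induction s using Finset.induction_on with
  | empty => exact finiteCob_const 0
  | insert i s hi ih =>
    rw [Finset.sum_insert hi]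
    exact (hφ i (by simp)).add (ih fun j hj => hφ j (by simp [hj]))

lemma FiniteCob.mono {T : SimpleGraph V} (hT : T ≤ G) {φ : V → ZMod 2} (hφ : FiniteCob G φ) :
    FiniteCob T φ :=
  hφ.subset fun _ he => ⟨SimpleGraph.edgeSet_mono hT he.1, he.2⟩

lemma cutValue_add (hh : SupportedOn G h) {φ ψ : V → ZMod 2} (hφ : FiniteCob G φ)
    (hψ : FiniteCob G ψ) : cutValue h (φ + ψ) = cutValue h φ + cutValue h ψ := by
  unfold cutValue
  rw [← finsum_add_distrib (hφ.support_finite hh) (hψ.support_finite hh)]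
  simp only [cob_add, mul_add]

lemma cutValue_const (c : ZMod 2) : cutValue h (fun _ => c) = 0 := by
  simp [cutValue, cob_const]

lemma cutValue_sum (hh : SupportedOn G h) {ι : Type*} (s : Finset ι) {φ : ι → V → ZMod 2}
    (hφ : ∀ i ∈ s, FiniteCob G (φ i)) :
    cutValue h (∑ i ∈ s, φ i) = ∑ i ∈ s, cutValue h (φ i) := by
  induction s using Finset.induction_on with
  | empty => exact cutValue_const 0
  | insert i s hi ih =>
    have h' : ∀ j ∈ s, FiniteCob G (φ j) := fun j hj => hφ j (by simp [hj])
    rw [Finset.sum_insert hi, Finset.sum_insert hi,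
      cutValue_add hh (hφ i (by simp)) (FiniteCob.sum s h'), ih h']

lemma cutValue_add_left {k : Sym2 V → ZMod 2} (hh : SupportedOn G h) (hk : SupportedOn G k)
    {φ : V → ZMod 2} (hφ : FiniteCob G φ) :
    cutValue (h + k) φ = cutValue h φ + cutValue k φ := by
  unfold cutValue
  rw [← finsum_add_distrib (hφ.support_finite hh) (hφ.support_finite hk)]
  simp only [Pi.add_apply, add_mul]

lemma cutValue_congr (hh : SupportedOn G h) {φ ψ : V → ZMod 2}
    (hφψ : ∀ e ∈ G.edgeSet, cob φ e = cob ψ e) : cutValue h φ = cutValue h ψ := by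
  refine finsum_congr fun e => ?_
  by_cases he : h e = 0
  · simp [he]
  · rw [hφψ e (hh e he)]

/-- Only finitely many edges meet a finite set of vertices. -/
lemma finite_edges_meeting (hlf : ∀ v, (G.neighborSet v).Finite) {K : Set V} (hK : K.Finite) :
    {e ∈ G.edgeSet | ∃ v ∈ K, v ∈ e}.Finite := by
  refine (hK.biUnion fun v _ => (hlf v).image fun u => s(v, u)).subset ?_
  rintro e ⟨he, v, hv, hve⟩
  obtain ⟨u, rfl⟩ := hve
  exact Set.mem_biUnion hv ⟨u, he, rfl⟩

lemma finiteCob_of_finite (hlf : ∀ v, (G.neighborSet v).Finite) {K : Set V} (hK : K.Finite)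
    {φ : V → ZMod 2} (hφ : ∀ u v, G.Adj u v → u ∉ K → v ∉ K → φ u = φ v) : FiniteCob G φ := by
  refine (finite_edges_meeting hlf hK).subset ?_
  rintro ⟨u, v⟩ ⟨he, hne⟩
  refine ⟨he, ?_⟩
  by_contra hcon
  push Not at hcon
  refine hne ?_
  change φ u + φ v = 0
  rw [hφ u v he (fun hu => hcon u hu (Sym2.mem_mk_left u v))
    (fun hv => hcon v hv (Sym2.mem_mk_right u v)), CharTwo.add_self_eq_zero]

lemma finiteCob_of_finite_support (hlf : ∀ v, (G.neighborSet v).Finite) {φ : V → ZMod 2}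
    (hφ : (Function.support φ).Finite) : FiniteCob G φ :=
  finiteCob_of_finite hlf hφ fun u v _ hu hv => by
    rw [Function.notMem_support.1 hu, Function.notMem_support.1 hv]

lemma FiniteCob.exists_finset {φ : V → ZMod 2} (hφ : FiniteCob G φ) :
    ∃ K : Finset V, ∀ u v, G.Adj u v → u ∉ K → v ∉ K → φ u = φ v := by
  refine ⟨hφ.toFinset.biUnion fun e => e.toFinset, fun u v huv hu _ => ?_⟩
  by_contra hne
  refine hu (Finset.mem_biUnion.2 ⟨s(u, v), ?_, by simp⟩)
  exact (Set.Finite.mem_toFinset _).2 ⟨huv, fun h0 => hne (CharTwo.add_eq_zero.1 h0)⟩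

lemma cutValue_single {f : V → V → ZMod 2} (hs : ∀ u v, f u v = f v u) (v : V)
    (hf : f v v = 0) : cutValue (Sym2.lift ⟨f, hs⟩) (Pi.single v 1) = chainDivZ2 f v := by
  have hinj : Function.Injective fun u : V => s(u, v) := fun a b hab => Sym2.congr_left.1 hab
  unfold chainDivZ2 cutValue
  have h1 : ∀ u, f u v = (fun e => Sym2.lift ⟨f, hs⟩ e * cob (Pi.single v 1) e) s(u, v) := by
    intro u
    by_cases huv : u = v
    · subst huv; simp [hf]
    · simp [huv]
  rw [finsum_congr h1,
    ← finsum_mem_range (f := fun e => Sym2.lift ⟨f, hs⟩ e * cob (Pi.single v 1) e) hinj]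
  refine finsum_congr fun e => ?_
  by_cases he : e ∈ Set.range fun u : V => s(u, v)
  · simp [he]
  · simp only [he, finsum_false]
    induction e with | _ a b =>
    have ha : a ≠ v := fun hav => he ⟨b, by rw [hav]; exact Sym2.eq_swap⟩
    have hb : b ≠ v := fun hbv => he ⟨a, by rw [hbv]⟩
    simp [ha, hb]

/-- A chain with vanishing divergence has value `0` on the cut of a finite set of vertices. -/
lemma cutValue_eq_zero_of_finite (hlf : ∀ v, (G.neighborSet v).Finite) (hh : SupportedOn G h)
    (hdiv : ∀ v, cutValue h (Pi.single v 1) = 0) {φ : V → ZMod 2}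
    (hφ : (Function.support φ).Finite) : cutValue h φ = 0 := by
  have hsum : φ = ∑ v ∈ hφ.toFinset, Pi.single v 1 := by
    ext w
    rw [Finset.sum_apply]
    simp only [Pi.single_apply, Finset.sum_ite_eq, Set.Finite.mem_toFinset, Function.mem_support]
    split_ifs with hw
    · exact zmod_two_eq_one hw
    · exact not_not.1 hw
  rw [hsum, cutValue_sum hh, Finset.sum_eq_zero fun v _ => hdiv v]
  exact fun v _ => finiteCob_of_finite_support hlf
    ((Set.finite_singleton v).subset fun w hw => by_contra fun hne => hw (Pi.single_eq_of_ne hne _))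

end cuts

section walks

variable {G : SimpleGraph V}

/-- The mod-2 chain of a walk, as a function on edges. -/
noncomputable def walkCount {u v : V} (p : G.Walk u v) (e : Sym2 V) : ZMod 2 := (p.edges.count e : ZMod 2)

lemma walkCount_cons {u v w : V} (h : G.Adj u v) (p : G.Walk v w) (e : Sym2 V) :
    walkCount (SimpleGraph.Walk.cons h p) e = (if e = s(u, v) then 1 else 0) + walkCount p e := by
  simp only [walkCount, SimpleGraph.Walk.edges_cons, List.count_cons, beq_iff_eq,
    eq_comm (a := s(u, v))]
  push_cast
  exact add_comm _ _

lemma walkCount_eq_zero {u v : V} {p : G.Walk u v} {e : Sym2 V} (he : e ∉ p.edges) :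
    walkCount p e = 0 := by
  simp [walkCount, List.count_eq_zero_of_not_mem he]

lemma supportedOn_walkCount {u v : V} (p : G.Walk u v) : SupportedOn G (walkCount p) :=
  fun e he => p.edges_subset_edgeSet (by by_contra hne; exact he (walkCount_eq_zero hne))

lemma traversals_nil (u a b : V) : traversals (SimpleGraph.Walk.nil : G.Walk u u) a b = 0 :=
  Finset.card_eq_zero.2 (Finset.filter_empty _)

lemma traversals_cons {u v w : V} (h : G.Adj u v) (p : G.Walk v w) (a b : V) :
    traversals (SimpleGraph.Walk.cons h p) a b =
      (if u = a ∧ v = b then 1 else 0) + traversals p a b := by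
  unfold traversals
  rw [Finset.card_filter, SimpleGraph.Walk.length_cons,
    Finset.sum_range_succ', add_comm]
  simp only [SimpleGraph.Walk.getVert_cons_succ, SimpleGraph.Walk.getVert_zero, zero_add]
  exact congrArg _ (Finset.card_filter _ _).symm

lemma walkChainZ2_eq_walkCount {u v : V} (p : G.Walk u v) (a b : V) :
    walkChainZ2 p a b = walkCount p s(a, b) := by
  induction p with
  | nil => simp [walkChainZ2, traversals_nil, walkCount]
  | @cons u v w h p ih =>
    rw [walkCount_cons, ← ih, walkChainZ2, walkChainZ2, traversals_cons, traversals_cons]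
    push_cast
    have hne : u ≠ v := h.ne
    have key : ((if u = a ∧ v = b then 1 else 0) + (if u = b ∧ v = a then 1 else 0) : ZMod 2) =
        if s(a, b) = s(u, v) then 1 else 0 := by
      simp only [Sym2.eq_iff]
      split_ifs <;> first | rfl | (exfalso; grind)
    rw [← key]
    ring

lemma onWalk_iff {u v : V} (p : G.Walk u v) (a b : V) : OnWalk p a b ↔ s(a, b) ∈ p.edges := by
  induction p with
  | nil => simp [OnWalk]
  | @cons u v w h p ih =>
    rw [SimpleGraph.Walk.edges_cons, List.mem_cons, ← ih, Sym2.eq_iff]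
    constructor
    · rintro ⟨i, hi, hab⟩
      cases i with
      | zero => left; simp at hab; grind
      | succ i => exact Or.inr ⟨i, by simpa using hi, by simpa using hab⟩
    · rintro (hab | ⟨i, hi, hab⟩)
      · exact ⟨0, by simp, by simp; grind⟩
      · exact ⟨i + 1, by simpa using hi, by simpa using hab⟩

/-- The value of a walk on a finite cut only depends on its endpoints. -/
lemma cutValue_walkCount {u v : V} (p : G.Walk u v) {φ : V → ZMod 2} (hφ : FiniteCob G φ) :
    cutValue (walkCount p) φ = φ u + φ v := by
  induction p with
  | nil => simp [cutValue, walkCount, CharTwo.add_self_eq_zero]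
  | @cons u v w h p ih =>
    have hs : SupportedOn G (fun e => if e = s(u, v) then 1 else 0) := by
      intro e he
      have : e = s(u, v) := by by_contra hne; simp [hne] at he
      rw [this]; exact h
    have : walkCount (SimpleGraph.Walk.cons h p) =
        (fun e => if e = s(u, v) then 1 else 0) + walkCount p :=
      funext fun e => walkCount_cons h p e
    rw [this, cutValue_add_left hs (supportedOn_walkCount p) hφ, ih]
    have : cutValue (fun e => if e = s(u, v) then 1 else 0) φ = φ u + φ v := by
      unfold cutValue
      rw [finsum_eq_single _ s(u, v) (by intro e he; simp [he])]
      simp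
    rw [this]
    linear_combination CharTwo.add_self_eq_zero (φ v)

end walks

section konig

variable {G : SimpleGraph V}

lemma ConnAvoiding.eq_of_forall_adj {K : Set V} {a b : V} (hab : ConnAvoiding G K a b)
    {φ : V → ZMod 2} (hφ : ∀ u v, G.Adj u v → u ∉ K → v ∉ K → φ u = φ v) : φ a = φ b := by
  obtain ⟨p, hp⟩ := hab
  induction p with
  | nil => rfl
  | cons h p ih =>
    exact (hφ _ _ h (hp _ (by simp)) (hp _ (by simp))).trans (ih fun v hv => hp v (by simp [hv]))

lemma ConnAvoiding.trans {K : Set V} {a b c : V} (hab : ConnAvoiding G K a b)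
    (hbc : ConnAvoiding G K b c) : ConnAvoiding G K a c := by
  obtain ⟨p, hp⟩ := hab
  obtain ⟨q, hq⟩ := hbc
  refine ⟨p.append q, fun v hv => ?_⟩
  rcases (SimpleGraph.Walk.mem_support_append_iff _ _).1 hv with h | h
  exacts [hp v h, hq v h]

lemma ConnAvoiding.symm {K : Set V} {a b : V} (hab : ConnAvoiding G K a b) :
    ConnAvoiding G K b a := by
  obtain ⟨p, hp⟩ := hab
  exact ⟨p.reverse, fun v hv => hp v (by simpa using hv)⟩

lemma ConnAvoiding.left_notMem {K : Set V} {a b : V} (hab : ConnAvoiding G K a b) : a ∉ K :=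
  hab.choose_spec _ (SimpleGraph.Walk.start_mem_support _)

lemma ConnAvoiding.of_le {H : SimpleGraph V} (hle : H ≤ G) {K L : Set V} (hKL : K ⊆ L) {a b : V}
    (hab : ConnAvoiding H L a b) : ConnAvoiding G K a b := by
  obtain ⟨p, hp⟩ := hab
  exact ⟨p.mapLe hle, fun v hv hK => hp v (by simpa using hv) (hKL hK)⟩

/-- König's lemma for an ultrafilter: some ray starting at `o` converges to the same end as the
ultrafilter. -/
lemma exists_ray_of_ultrafilter (hlf : ∀ v, (G.neighborSet v).Finite) (o : V) (U : Ultrafilter V)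
    (hU : ∀ v, ∀ᶠ w in (U : Filter V), w ≠ v) (hr : ∀ᶠ w in (U : Filter V), G.Reachable o w) :
    ∃ x : ℕ → V, IsRay G x ∧ ∀ K : Finset V, ∃ N, ∀ n, N ≤ n →
      ∀ᶠ w in (U : Filter V), ConnAvoiding G (↑K) (x n) w := by
  let P : ℕ → V → Prop := fun k x => G.dist o x = k ∧ G.Reachable o x ∧
    ∀ᶠ w in (U : Filter V), G.dist o w = k + G.dist x w
  have hstep : ∀ k x, ∃ x', P k x → P (k + 1) x' ∧ G.Adj x x' := by
    intro k x
    by_cases hP : P k x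
    swap
    · exact ⟨x, fun h => absurd h hP⟩
    obtain ⟨hox, hrx, hev⟩ := hP
    have hex : ∀ᶠ w in (U : Filter V), ∃ x' ∈ G.neighborSet x,
        G.dist o w = k + 1 + G.dist x' w ∧ G.dist o x' = k + 1 := by
      filter_upwards [hev, hU x, hr] with w hw hne hrw
      obtain ⟨p, hp⟩ := (hrx.symm.trans hrw).exists_walk_length_eq_dist
      cases p with
      | nil => exact absurd rfl hne
      | @cons _ x' _ hadj q =>
        rw [SimpleGraph.Walk.length_cons] at hp
        have h1 : G.dist x' w ≤ q.length := SimpleGraph.dist_le q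
        obtain ⟨r, hr'⟩ := hrx.exists_walk_length_eq_dist
        have h2 : G.dist o x' ≤ k + 1 := by
          have := SimpleGraph.dist_le (r.concat hadj)
          rw [SimpleGraph.Walk.length_concat] at this
          omega
        obtain ⟨s, hs⟩ := (hrx.trans hadj.reachable).exists_walk_length_eq_dist
        obtain ⟨t, ht⟩ := q.reachable.exists_walk_length_eq_dist
        have h3 := SimpleGraph.dist_le (s.append t)
        rw [SimpleGraph.Walk.length_append] at h3
        exact ⟨x', hadj, by omega, by omega⟩
    obtain ⟨x', hx', hev'⟩ :=
      (Ultrafilter.eventually_exists_mem_iff (f := U) (hlf x)).1 hex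
    obtain ⟨w, hw⟩ := hev'.exists
    exact ⟨x', fun _ => ⟨⟨hw.2, hrx.trans (SimpleGraph.Adj.reachable hx'),
      hev'.mono fun _ h => h.1⟩, hx'⟩⟩
  choose nxt hnxt using hstep
  let x : ℕ → V := fun n => Nat.rec o (fun k y => nxt k y) n
  have hx : ∀ n, P n (x n) := by
    intro n
    induction n with
    | zero => exact ⟨SimpleGraph.dist_self, SimpleGraph.Reachable.refl _, by simp [x]⟩
    | succ n ih => exact (hnxt n (x n) ih).1
  refine ⟨x, ⟨fun m n hmn => ?_, fun n => (hnxt n (x n) (hx n)).2⟩, fun K => ?_⟩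
  · rw [← (hx m).1, ← (hx n).1, hmn]
  · refine ⟨K.sup (G.dist o) + 1, fun n hn => ?_⟩
    filter_upwards [(hx n).2.2, hr] with w hw hrw
    obtain ⟨p, hp⟩ := ((hx n).2.1.symm.trans hrw).exists_walk_length_eq_dist
    refine ⟨p, fun z hz hzK => ?_⟩
    have h1 : G.dist o z ≤ K.sup (G.dist o) := Finset.le_sup (f := G.dist o) hzK
    have hlen := congrArg SimpleGraph.Walk.length (p.take_spec hz)
    rw [SimpleGraph.Walk.length_append] at hlen
    obtain ⟨r, hr'⟩ := ((hx n).2.1.trans (p.takeUntil z hz).reachable).exists_walk_length_eq_dist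
    have h2 := SimpleGraph.dist_le (r.append (p.dropUntil z hz))
    rw [SimpleGraph.Walk.length_append] at h2
    have h3 : G.dist (x n) z ≤ (p.takeUntil z hz).length := SimpleGraph.dist_le _
    omega

end konig

section ends

variable {G T : SimpleGraph V}

/-- A finite cut of a subtree respecting ends extends, up to finitely many vertices, to a finite
cut of the ambient graph. -/
lemma exists_finiteCob_extension (hlf : ∀ v, (G.neighborSet v).Finite) (hle : T ≤ G)
    (hTc : ConnectedIn T T.support) (hT : T.support.Nonempty) (hend : EndRespecting G T)
    {ψ : V → ZMod 2} (hψ : FiniteCob T ψ) :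
    ∃ φ : V → ZMod 2, FiniteCob G φ ∧ {v ∈ T.support | φ v ≠ ψ v}.Finite := by
  have hlfT : ∀ v, (T.neighborSet v).Finite := fun v => (hlf v).subset fun u hu => hle hu
  obtain ⟨M, hM⟩ := hψ.exists_finset
  obtain ⟨o, ho⟩ := hT
  by_cases hsep : ∃ K : Finset V, ∀ p ∈ T.support, ∀ q ∈ T.support,
      ConnAvoiding G (↑K) p q → ψ p = ψ q
  · obtain ⟨K, hK⟩ := hsep
    let φ : V → ZMod 2 := fun v =>
      if ∃ w ∈ T.support, ConnAvoiding G (↑K) v w ∧ ψ w = 1 then 1 else 0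
    refine ⟨φ, finiteCob_of_finite hlf K.finite_toSet fun u v huv hu hv => ?_,
      K.finite_toSet.subset ?_⟩
    · have huv' : ConnAvoiding G (↑K) u v :=
        ⟨huv.toWalk, fun z hz => by
          simp only [SimpleGraph.Adj.toWalk, SimpleGraph.Walk.support_cons,
            SimpleGraph.Walk.support_nil, List.mem_cons, List.not_mem_nil, or_false] at hz
          rcases hz with rfl | rfl <;> assumption⟩
      have : (∃ w ∈ T.support, ConnAvoiding G (↑K) u w ∧ ψ w = 1) ↔
          ∃ w ∈ T.support, ConnAvoiding G (↑K) v w ∧ ψ w = 1 :=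
        ⟨fun ⟨w, hw, h1, h2⟩ => ⟨w, hw, huv'.symm.trans h1, h2⟩,
          fun ⟨w, hw, h1, h2⟩ => ⟨w, hw, huv'.trans h1, h2⟩⟩
      simp only [φ, this]
    · rintro v ⟨hv, hne⟩
      by_contra hvK
      refine hne ?_
      have hvv : ConnAvoiding G (↑K) v v := ⟨SimpleGraph.Walk.nil, by simpa using hvK⟩
      by_cases hv1 : ψ v = 1
      · simp only [φ, hv1]
        exact if_pos ⟨v, hv, hvv, hv1⟩
      · simp only [φ]
        rw [if_neg]
        · by_contra h0
          exact hv1 (zmod_two_eq_one (Ne.symm h0))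
        · rintro ⟨w, hw, hvw, hw1⟩
          exact hv1 ((hK v hv w hw hvw).trans hw1)
  · exfalso
    have hbad : ∀ K : Finset V, ∃ p q, p ∈ T.support ∧ q ∈ T.support ∧
        ConnAvoiding G (↑K) p q ∧ ψ p = 1 ∧ ψ q = 0 := by
      intro K
      push Not at hsep
      obtain ⟨p, hp, q, hq, hpq, hne⟩ := hsep K
      by_cases hp1 : ψ p = 0
      · exact ⟨q, p, hq, hp, hpq.symm, zmod_two_eq_one fun h => hne (hp1.trans h.symm), hp1⟩
      · have hp1 := zmod_two_eq_one hp1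
        exact ⟨p, q, hp, hq, hpq, hp1, by
          by_contra hq0; exact hne (hp1.trans (zmod_two_eq_one hq0).symm)⟩
    choose p q hp hq hpq hp1 hq0 using hbad
    let W : Ultrafilter (Finset V) := Ultrafilter.of Filter.atTop
    have hW : ∀ K : Finset V, ∀ᶠ L in (W : Filter (Finset V)), K ⊆ L := fun K =>
      Ultrafilter.of_le _ (Filter.eventually_ge_atTop K)
    have hray : ∀ r : Finset V → V, (∀ K, r K ∈ T.support) → (∀ K, r K ∉ K) →
        ∃ x : ℕ → V, IsRay T x ∧ ∀ K : Finset V, ∃ N, ∀ n, N ≤ n →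
          ∀ᶠ L in (W : Filter (Finset V)), ConnAvoiding T (↑K) (x n) (r L) := by
      intro r hr hrK
      refine exists_ray_of_ultrafilter hlfT o (W.map r) (fun v => ?_) ?_
      · refine Filter.eventually_map.2 ((hW {v}).mono fun L hL hv => hrK L ?_)
        rw [hv]
        exact hL (Finset.mem_singleton_self v)
      · refine Filter.eventually_map.2 (Filter.Eventually.of_forall fun L => ?_)
        obtain ⟨p, -⟩ := hTc o ho (r L) (hr L)
        exact p.reachable
    obtain ⟨x, hx, hxp⟩ := hray p hp fun K => (hpq K).left_notMem
    obtain ⟨y, hy, hyq⟩ := hray q hq fun K => (hpq K).symm.left_notMem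
    have hxy : RayEquiv G x y := by
      intro K
      obtain ⟨N, hN⟩ := hxp K
      obtain ⟨N', hN'⟩ := hyq K
      refine ⟨max N N', fun n hn m hm => ?_⟩
      obtain ⟨L, ⟨hL1, hL2⟩, hL3⟩ := (((hN n (le_of_max_le_left hn)).and
        (hN' m (le_of_max_le_right hm))).and (hW K)).exists
      exact ((hL1.of_le hle subset_rfl).trans
        ((hpq L).of_le le_rfl (Finset.coe_subset.2 hL3))).trans (hL2.of_le hle subset_rfl).symm
    obtain ⟨N, hN⟩ := hend x y hx hy hxy M
    obtain ⟨N₁, hN₁⟩ := hxp M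
    obtain ⟨N₂, hN₂⟩ := hyq M
    let n := max N (max N₁ N₂)
    obtain ⟨L, hL1, hL2⟩ := ((hN₁ n (by omega)).and (hN₂ n (by omega))).exists
    have h01 := ((hL1.symm.trans (hN n (by omega) n (by omega))).trans hL2).eq_of_forall_adj hM
    rw [hp1, hq0] at h01
    exact one_ne_zero h01

/-- If every end of `G` is represented by a ray of `T`, a finite cut of `G` with infinitely many
vertices on one side has infinitely many vertices of `T` on that side. -/
lemma finite_support_of_finite_on_support (hlf : ∀ v, (G.neighborSet v).Finite)
    (hconn : G.Connected)
    (hrep : ∀ x : ℕ → V, IsRay G x → ∃ y : ℕ → V, IsRay T y ∧ RayEquiv G x y)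
    {φ : V → ZMod 2} (hφ : FiniteCob G φ) (hfin : {v ∈ T.support | φ v ≠ 0}.Finite) :
    (Function.support φ).Finite := by
  by_contra hinf
  obtain ⟨K, hK⟩ := hφ.exists_finset
  have hne : (Filter.cofinite ⊓ Filter.principal (Function.support φ)).NeBot :=
    Filter.cofinite_inf_principal_neBot_iff.2 hinf
  let U : Ultrafilter V := Ultrafilter.of (Filter.cofinite ⊓ Filter.principal (Function.support φ))
  have hU := Ultrafilter.of_le (Filter.cofinite ⊓ Filter.principal (Function.support φ))
  have hUφ : ∀ᶠ w in (U : Filter V), φ w ≠ 0 :=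
    hU (Filter.mem_inf_of_right (Filter.mem_principal_self _))
  obtain ⟨o⟩ := hconn.nonempty
  obtain ⟨x, hx, hxU⟩ := exists_ray_of_ultrafilter hlf o U
    (fun v => hU (Filter.mem_inf_of_left (Set.finite_singleton v).compl_mem_cofinite))
    (Filter.Eventually.of_forall fun w => hconn.preconnected o w)
  obtain ⟨y, hy, hxy⟩ := hrep x hx
  obtain ⟨N, hN⟩ := hxU K
  obtain ⟨N', hN'⟩ := hxy K
  refine Set.infinite_of_injective_forall_mem (f := fun m => y (N' + m))
    (fun a b hab => by simpa using hy.1 hab) (fun m => ?_) hfin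
  refine ⟨⟨_, hy.2 _⟩, ?_⟩
  obtain ⟨w, hw, hw'⟩ := ((hN (max N N') (le_max_left _ _)).and hUφ).exists
  rw [← (hN' (max N N') (le_max_right _ _) (N' + m) (by omega)).eq_of_forall_adj hK,
    hw.eq_of_forall_adj hK]
  exact hw'

end ends

section circuits

variable {G : SimpleGraph V}

/-- A potential for a function on edges that vanishes on all circuits. -/
lemma exists_potential (ψ : Sym2 V → ZMod 2)
    (hψ : ∀ c : Circuit G, ((c.2.edges.map ψ).sum = 0)) :
    ∃ φ : V → ZMod 2, ∀ e ∈ G.edgeSet, cob φ e = ψ e := by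
  let base : V → V := fun v => (G.connectedComponentMk v).out
  have hbase : ∀ v, G.Reachable (base v) v := fun v =>
    SimpleGraph.ConnectedComponent.exact (Quot.out_eq _)
  refine ⟨fun v => ((hbase v).some.edges.map ψ).sum, ?_⟩
  rintro ⟨u, v⟩ (huv : G.Adj u v)
  change _ + _ = ψ s(u, v)
  have key : ∀ a b : V, a = b → ∀ (p : G.Walk a u) (q : G.Walk b v),
      (p.edges.map ψ).sum + (q.edges.map ψ).sum = ψ s(u, v) := by
    rintro a _ rfl p q
    have := hψ ⟨a, (p.concat huv).append q.reverse⟩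
    simp only [SimpleGraph.Walk.edges_append, SimpleGraph.Walk.edges_concat,
      SimpleGraph.Walk.edges_reverse, List.map_append, List.sum_append, List.map_reverse,
      List.sum_reverse, List.concat_eq_append, List.map_cons, List.map_nil, List.sum_cons,
      List.sum_nil, add_zero] at this
    rw [← CharTwo.add_eq_zero, ← this]
    ring
  refine key _ _ ?_ _ _
  have : G.connectedComponentMk u = G.connectedComponentMk v :=
    SimpleGraph.ConnectedComponent.sound huv.reachable
  simp only [base, this]

lemma sum_map_edges {u v : V} (p : G.Walk u v) (E : Finset (Sym2 V)) (ψ : Sym2 V → ZMod 2)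
    (hψ : ∀ e ∉ E, ψ e = 0) : (p.edges.map ψ).sum = ∑ e ∈ E, walkCount p e * ψ e := by
  rw [Finset.sum_list_map_count]
  simp only [nsmul_eq_mul]
  have h1 : ∀ s : Finset (Sym2 V), p.edges.toFinset ⊆ s → ∑ e ∈ p.edges.toFinset,
      (p.edges.count e : ZMod 2) * ψ e = ∑ e ∈ s, walkCount p e * ψ e := by
    intro s hs
    refine Finset.sum_subset hs fun e _ he => ?_
    rw [List.mem_toFinset] at he
    rw [List.count_eq_zero_of_not_mem he]
    simp
  rw [h1 (p.edges.toFinset ∪ E) Finset.subset_union_left]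
  symm
  exact Finset.sum_subset Finset.subset_union_right fun e _ he => by rw [hψ e he, mul_zero]

/-- `h` vanishes on every finite cut. -/
def EvenOnCuts (G : SimpleGraph V) (h : Sym2 V → ZMod 2) : Prop :=
  ∀ φ, FiniteCob G φ → cutValue h φ = 0

/-- The chain of a finitely supported family of circuits. -/
noncomputable def circuitCombo (G : SimpleGraph V) (g : Circuit G →₀ ZMod 2) :
    Sym2 V → ZMod 2 :=
  fun e => g.sum fun c a => a * walkCount c.2 e

/-- A chain that is even on all finite cuts and avoids a finite set `F` of edges agrees on any
finite set of edges with a finite combination of circuits avoiding `F`. -/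
lemma exists_circuitCombo_eqOn {h : Sym2 V → ZMod 2} (hh : SupportedOn G h)
    (heven : EvenOnCuts G h) (F E : Finset (Sym2 V)) (hF : ∀ e ∈ F, h e = 0) :
    ∃ g : Circuit G →₀ ZMod 2, (∀ c, g c ≠ 0 → ∀ e ∈ F, e ∉ c.2.edges) ∧
      ∀ e ∈ E, circuitCombo G g e = h e := by
  let S : Set (Circuit G) := {c | ∀ e ∈ F, e ∉ c.2.edges}
  let r : Circuit G → (E → ZMod 2) := fun c e => walkCount c.2 e
  by_cases hmem : (fun e : E => h e) ∈ Submodule.span (ZMod 2) (r '' S)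
  · obtain ⟨g, hg, hgh⟩ := (Finsupp.mem_span_image_iff_linearCombination _).1 hmem
    refine ⟨g, fun c hc => hg (Finsupp.mem_support_iff.2 hc), fun e he => ?_⟩
    have := congrFun hgh ⟨e, he⟩
    rw [← this, Finsupp.linearCombination_apply, Finsupp.sum_apply']
    rfl
  · exfalso
    obtain ⟨f, hf, hfle⟩ := Submodule.exists_le_ker_of_notMem hmem
    let ψ : Sym2 V → ZMod 2 := fun e => if he : e ∈ E then f (Pi.single ⟨e, he⟩ 1) else 0
    have hψ0 : ∀ e ∉ E, ψ e = 0 := fun e he => dif_neg he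
    have hfψ : ∀ k : Sym2 V → ZMod 2, f (fun e : E => k e) = ∑ e ∈ E, k e * ψ e := by
      intro k
      rw [LinearMap.pi_apply_eq_sum_univ f, ← Finset.sum_coe_sort E]
      refine Finset.sum_congr rfl fun e _ => ?_
      simp only [ψ, e.2, dif_pos, smul_eq_mul]
      congr 2
      ext i
      simp [Pi.single_apply, eq_comm]
    let H : SimpleGraph V := G.deleteEdges ↑F
    have hHG : H ≤ G := G.deleteEdges_le _
    obtain ⟨φ, hφ⟩ := exists_potential (G := H) ψ (by
      rintro ⟨a, p⟩
      have hp : (⟨a, p.mapLe hHG⟩ : Circuit G) ∈ S := by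
        intro e he hep
        rw [SimpleGraph.Walk.edges_mapLe_eq_edges] at hep
        have := p.edges_subset_edgeSet hep
        simp only [H, SimpleGraph.edgeSet_deleteEdges] at this
        exact this.2 he
      have h0 : f (r ⟨a, p.mapLe hHG⟩) = 0 :=
        hfle (Submodule.subset_span ⟨_, hp, rfl⟩)
      rw [← SimpleGraph.Walk.edges_mapLe_eq_edges hHG, sum_map_edges _ E ψ hψ0, ← hfψ]
      exact h0)
    have hφ' : ∀ e ∈ G.edgeSet, e ∉ F → cob φ e = ψ e := by
      intro e he heF
      refine hφ e ?_
      simp only [H, SimpleGraph.edgeSet_deleteEdges]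
      exact ⟨he, heF⟩
    have hfin : FiniteCob G φ := by
      refine (F ∪ E).finite_toSet.subset fun e ⟨he, hne⟩ => ?_
      by_contra hcon
      simp only [Finset.coe_union, Set.mem_union, Finset.mem_coe, not_or] at hcon
      exact hne ((hφ' e he hcon.1).trans (hψ0 e hcon.2))
    refine hf ?_
    rw [hfψ h, ← heven φ hfin, cutValue, finsum_eq_sum_of_support_subset (s := E)]
    · refine Finset.sum_congr rfl fun e _ => ?_
      by_cases h0 : h e = 0
      · simp [h0]
      · rw [hφ' e (hh e h0) fun heF => h0 (hF e heF)]
    · intro e he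
      by_contra heE
      have h0 := left_ne_zero_of_mul he
      refine right_ne_zero_of_mul he ?_
      rw [hφ' e (hh e h0) fun heF => h0 (hF e heF), hψ0 e heE]

lemma supportedOn_circuitCombo (g : Circuit G →₀ ZMod 2) : SupportedOn G (circuitCombo G g) := by
  intro e he
  obtain ⟨c, -, hc⟩ := Finset.exists_ne_zero_of_sum_ne_zero he
  exact supportedOn_walkCount c.2 e (right_ne_zero_of_mul hc)

/-- Any thin sum of circuits, here only required to be so along each edge, is even on cuts. -/
lemma evenOnCuts_finsum {g : Circuit G → ZMod 2}
    (hg : ∀ e, {c : Circuit G | g c ≠ 0 ∧ e ∈ c.2.edges}.Finite) :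
    EvenOnCuts G fun e => ∑ᶠ c : Circuit G, g c * walkCount c.2 e := by
  intro φ hφ
  let E : Finset (Sym2 V) := Set.Finite.toFinset hφ
  have hE : ∀ e ∈ G.edgeSet, e ∉ E → cob φ e = 0 := fun e he heE => by
    by_contra hne
    exact heE ((Set.Finite.mem_toFinset _).2 ⟨he, hne⟩)
  have hcut : ∀ k : Sym2 V → ZMod 2, SupportedOn G k → cutValue k φ = ∑ e ∈ E, k e * cob φ e := by
    intro k hk
    refine finsum_eq_sum_of_support_subset _ fun e he => ?_
    by_contra heE
    exact right_ne_zero_of_mul he (hE e (hk e (left_ne_zero_of_mul he)) heE)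
  have hfin : ∀ e, (Function.support fun c : Circuit G => g c * walkCount c.2 e).Finite := fun e =>
    (hg e).subset fun c hc => ⟨left_ne_zero_of_mul hc, by
      by_contra hne; exact right_ne_zero_of_mul hc (walkCount_eq_zero hne)⟩
  let C : Finset (Circuit G) := E.biUnion fun e => (hfin e).toFinset
  have hsum : ∀ e ∈ E, ∑ᶠ c : Circuit G, g c * walkCount c.2 e =
      ∑ c ∈ C, g c * walkCount c.2 e := fun e he =>
    finsum_eq_sum_of_support_subset _ fun c hc =>
      Finset.mem_biUnion.2 ⟨e, he, (Set.Finite.mem_toFinset _).2 hc⟩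
  rw [hcut]
  · rw [Finset.sum_congr rfl fun e he => by rw [hsum e he, Finset.sum_mul], Finset.sum_comm]
    refine Finset.sum_eq_zero fun c _ => ?_
    have := cutValue_walkCount c.2 hφ
    rw [hcut _ (supportedOn_walkCount c.2), CharTwo.add_self_eq_zero] at this
    simp only [mul_assoc]
    rw [← Finset.mul_sum, this, mul_zero]
  · intro e he
    obtain ⟨c, hc⟩ : ∃ c : Circuit G, g c * walkCount c.2 e ≠ 0 := by
      by_contra! hcon
      exact he (finsum_eq_zero_of_forall_eq_zero hcon)
    exact supportedOn_walkCount c.2 e (right_ne_zero_of_mul hc)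

lemma evenOnCuts_circuitCombo (g : Circuit G →₀ ZMod 2) : EvenOnCuts G (circuitCombo G g) := by
  have := evenOnCuts_finsum (g := g) fun e =>
    g.support.finite_toSet.subset fun c hc => Finsupp.mem_support_iff.2 hc.1
  convert this using 2 with e
  refine (finsum_eq_sum_of_support_subset _ fun c hc => ?_).symm
  exact Finsupp.mem_support_iff.2 (left_ne_zero_of_mul hc)

lemma evenOnCuts_of_mem_CthinZ2 {f : V → V → ZMod 2} (hf : f ∈ CthinZ2 G)
    (hs : ∀ u v, f u v = f v u) : EvenOnCuts G (Sym2.lift ⟨f, hs⟩) := by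
  obtain ⟨g, hg, rfl⟩ := hf
  convert evenOnCuts_finsum (g := g) ?_ using 1
  · ext ⟨a, b⟩
    exact finsum_congr fun c => by rw [walkChainZ2_eq_walkCount]
  · rintro ⟨a, b⟩
    exact (hg a b).subset fun c hc => ⟨hc.1, (onWalk_iff _ _ _).2 hc.2⟩

/-- In a countable graph, a chain that is even on all finite cuts is a thin sum of circuits. -/
lemma mem_CthinZ2_of_evenOnCuts [Countable V] [Nonempty V] {h : Sym2 V → ZMod 2}
    (hh : SupportedOn G h) (heven : EvenOnCuts G h) : (fun a b => h s(a, b)) ∈ CthinZ2 G := by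
  have : Countable (Sym2 V) := inferInstanceAs (Countable (Quot _))
  have : Nonempty (Sym2 V) := ⟨s(Classical.arbitrary V, Classical.arbitrary V)⟩
  obtain ⟨en, hen⟩ := exists_surjective_nat (Sym2 V)
  let F : ℕ → Finset (Sym2 V) := fun n => (Finset.range n).image en
  let Good : (Sym2 V → ZMod 2) → ℕ → Prop := fun k n =>
    SupportedOn G k ∧ EvenOnCuts G k ∧ ∀ e ∈ F n, k e = 0
  have hstep : ∀ k n, ∃ g : Circuit G →₀ ZMod 2, Good k n →
      (∀ c, g c ≠ 0 → ∀ e ∈ F n, e ∉ c.2.edges) ∧ ∀ e ∈ F (n + 1), circuitCombo G g e = k e := by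
    intro k n
    by_cases hk : Good k n
    · obtain ⟨g, hg⟩ := exists_circuitCombo_eqOn hk.1 hk.2.1 (F n) (F (n + 1)) hk.2.2
      exact ⟨g, fun _ => hg⟩
    · exact ⟨0, fun h' => absurd h' hk⟩
  choose st hst using hstep
  let k : ℕ → Sym2 V → ZMod 2 := fun n => Nat.rec h (fun n k => k + circuitCombo G (st k n)) n
  have hk1 : ∀ n, k (n + 1) = k n + circuitCombo G (st (k n) n) := fun _ => rfl
  have hk : ∀ n, Good (k n) n := by
    intro n
    induction n with
    | zero => exact ⟨hh, heven, by simp [F]⟩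
    | succ n ih =>
      rw [hk1]
      refine ⟨fun e he => ?_, fun φ hφ => ?_, fun e he => ?_⟩
      · by_contra hne
        have h1 : k n e = 0 := by by_contra h0; exact hne (ih.1 e h0)
        have h2 : circuitCombo G (st (k n) n) e = 0 := by
          by_contra h0; exact hne (supportedOn_circuitCombo _ e h0)
        exact he (by rw [Pi.add_apply, h1, h2, add_zero])
      · rw [cutValue_add_left ih.1 (supportedOn_circuitCombo _) hφ, ih.2.1 φ hφ,
          evenOnCuts_circuitCombo _ φ hφ, add_zero]
      · rw [Pi.add_apply, (hst (k n) n ih).2 e he, CharTwo.add_self_eq_zero]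
  let g : ℕ → Circuit G →₀ ZMod 2 := fun n => st (k n) n
  have hg : ∀ n m c, n < m → en n ∈ c.2.edges → g m c = 0 := by
    intro n m c hnm hc
    by_contra hne
    exact (hst (k m) m (hk m)).1 c hne (en n)
      (Finset.mem_image_of_mem en (Finset.mem_range.2 hnm)) hc
  have hsum : ∀ n e, k n e = h e + ∑ i ∈ Finset.range n, circuitCombo G (g i) e := by
    intro n e
    induction n with
    | zero => simp [k]
    | succ n ih => rw [hk1, Pi.add_apply, ih, Finset.sum_range_succ, add_assoc]
  let a : Circuit G → ZMod 2 := fun c => ∑ᶠ n, g n c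
  have ha : ∀ n c, en n ∈ c.2.edges → a c = ∑ i ∈ Finset.range (n + 1), g i c := by
    intro n c hc
    refine finsum_eq_sum_of_support_subset _ fun m hm => ?_
    by_contra hmn
    exact hm (hg n m c (by simpa using hmn) hc)
  let C : ℕ → Finset (Circuit G) := fun n => (Finset.range (n + 1)).biUnion fun i => (g i).support
  have hC : ∀ n c, a c ≠ 0 → en n ∈ c.2.edges → c ∈ C n := by
    intro n c hac hc
    rw [ha n c hc] at hac
    obtain ⟨i, hi, hne⟩ := Finset.exists_ne_zero_of_sum_ne_zero hac
    exact Finset.mem_biUnion.2 ⟨i, hi, Finsupp.mem_support_iff.2 hne⟩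
  refine ⟨a, fun u v => ?_, ?_⟩
  · obtain ⟨n, hn⟩ := hen s(u, v)
    refine (C n).finite_toSet.subset fun c hc => hC n c hc.1 ?_
    rw [hn]
    exact (onWalk_iff _ _ _).1 hc.2
  · ext u v
    obtain ⟨n, hn⟩ := hen s(u, v)
    simp only [circSumZ2, walkChainZ2_eq_walkCount]
    rw [← hn, finsum_eq_sum_of_support_subset (s := C n)]
    · have hmul : ∀ c ∈ C n, a c * walkCount c.2 (en n) =
          ∑ i ∈ Finset.range (n + 1), g i c * walkCount c.2 (en n) := by
        intro c _
        by_cases hc : en n ∈ c.2.edges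
        · rw [ha n c hc, Finset.sum_mul]
        · simp [walkCount_eq_zero hc]
      rw [Finset.sum_congr rfl hmul, Finset.sum_comm]
      have h0 : k (n + 1) (en n) = 0 := (hk (n + 1)).2.2 _
        (Finset.mem_image_of_mem en (Finset.mem_range.2 n.lt_succ_self))
      rw [CharTwo.add_eq_zero.1 ((hsum (n + 1) (en n)).symm.trans h0)]
      refine Finset.sum_congr rfl fun i hi => ?_
      exact Finset.sum_subset (Finset.subset_biUnion_of_mem (fun i => (g i).support) hi)
        fun c _ hc => by
          rw [Finsupp.notMem_support_iff.1 hc]; exact zero_mul _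
    · intro c hc
      refine hC n c (left_ne_zero_of_mul hc) ?_
      by_contra hne
      exact right_ne_zero_of_mul hc (walkCount_eq_zero hne)

end circuits

/-- A connected locally finite graph is countable. -/
lemma countable_of_locallyFinite {G : SimpleGraph V} (hlf : ∀ v, (G.neighborSet v).Finite)
    (hconn : G.Connected) : Countable V := by
  obtain ⟨o⟩ := hconn.nonempty
  let B : ℕ → Set V := fun n => Nat.rec {o} (fun _ S => ⋃ v ∈ S, G.neighborSet v) n
  have hB : ∀ n, (B n).Finite := by
    intro n
    induction n with
    | zero => exact Set.finite_singleton o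
    | succ n ih => exact ih.biUnion fun v _ => hlf v
  have hwalk : ∀ (u v : V) (p : G.Walk u v) (n : ℕ), u ∈ B n → ∃ m, v ∈ B m := by
    intro u v p
    induction p with
    | nil => exact fun n hn => ⟨n, hn⟩
    | cons h p ih => exact fun n hn => ih (n + 1) (Set.mem_biUnion hn h)
  refine Set.countable_univ_iff.1 ((Set.countable_iUnion fun n => (hB n).countable).mono ?_)
  intro v _
  obtain ⟨p⟩ := hconn.preconnected o v
  exact Set.mem_iUnion.2 (hwalk o v p 0 (Set.mem_singleton o))

/-- Each edge of an acyclic graph is a cut by itself. -/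
lemma exists_cob_eq_ite {T : SimpleGraph V} (hT : T.IsAcyclic) {e : Sym2 V} (he : e ∈ T.edgeSet) :
    ∃ ψ : V → ZMod 2, ∀ e' ∈ T.edgeSet, cob ψ e' = if e' = e then 1 else 0 := by
  have hbr := SimpleGraph.isAcyclic_iff_forall_isBridge.1 hT he
  induction e with | _ a b =>
  rw [SimpleGraph.isBridge_iff] at hbr
  refine ⟨fun w => if (T.deleteEdges {s(a, b)}).Reachable a w then 1 else 0, ?_⟩
  rintro ⟨u, v⟩ (huv : T.Adj u v)
  change _ + _ = if s(u, v) = s(a, b) then (1 : ZMod 2) else 0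
  by_cases hne : s(u, v) = s(a, b)
  · rw [if_pos hne]
    rcases Sym2.eq_iff.1 hne with ⟨rfl, rfl⟩ | ⟨rfl, rfl⟩ <;> simp [hbr]
  · have hadj : (T.deleteEdges {s(a, b)}).Adj u v := by
      rw [SimpleGraph.deleteEdges_adj]
      exact ⟨huv, hne⟩
    have hiff : (T.deleteEdges {s(a, b)}).Reachable a u ↔ (T.deleteEdges {s(a, b)}).Reachable a v :=
      ⟨fun h => h.trans hadj.reachable, fun h => h.trans hadj.symm.reachable⟩
    rw [if_neg hne]
    simp only [hiff, CharTwo.add_self_eq_zero]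

section main

variable {G T : SimpleGraph V}

lemma finiteCob_of_cob_eq_ite {ψ : V → ZMod 2} {e : Sym2 V}
    (hψ : ∀ e' ∈ T.edgeSet, cob ψ e' = if e' = e then 1 else 0) : FiniteCob T ψ := by
  refine (Set.finite_singleton e).subset fun e' ⟨he', hne⟩ => ?_
  by_contra hcon
  exact hne ((hψ e' he').trans (if_neg hcon))

/-- A chain on `T` without divergence has the same value on cuts that agree on all but finitely
many vertices of `T`. -/
lemma cutValue_eq_of_finite_ne (hlf : ∀ v, (T.neighborSet v).Finite) {h : Sym2 V → ZMod 2}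
    (hh : SupportedOn T h) (hdiv : ∀ v, cutValue h (Pi.single v 1) = 0) {φ ψ : V → ZMod 2}
    (hψ : FiniteCob T ψ) (hfin : {v ∈ T.support | φ v ≠ ψ v}.Finite) :
    cutValue h φ = cutValue h ψ := by
  let δ : V → ZMod 2 := fun v => if v ∈ T.support then φ v + ψ v else 0
  have hδ : (Function.support δ).Finite := by
    refine hfin.subset fun v hv => ?_
    have hvT : v ∈ T.support := by
      by_contra hne; exact hv (if_neg hne)
    refine ⟨hvT, fun heq => hv ?_⟩
    simp only [δ, if_pos hvT, heq, CharTwo.add_self_eq_zero]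
  have hcongr : cutValue h φ = cutValue h (ψ + δ) := by
    refine cutValue_congr hh ?_
    rintro ⟨u, v⟩ (huv : T.Adj u v)
    have hu : u ∈ T.support := ⟨v, huv⟩
    have hv : v ∈ T.support := ⟨u, huv.symm⟩
    change φ u + φ v = (ψ u + δ u) + (ψ v + δ v)
    simp only [δ, if_pos hu, if_pos hv]
    linear_combination -CharTwo.add_self_eq_zero (ψ u) - CharTwo.add_self_eq_zero (ψ v)
  rw [hcongr, cutValue_add hh hψ (finiteCob_of_finite_support hlf hδ),
    cutValue_eq_zero_of_finite hlf hh hdiv hδ, add_zero]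

/-- The value of a chain of `G` on finite cuts only depends on its values on the cuts extending
the edges of an end-defining tree `T`. -/
lemma cutValue_eq_cutValue_of_tree (hlf : ∀ v, (G.neighborSet v).Finite) (hconn : G.Connected)
    (hle : T ≤ G) (hTc : ConnectedIn T T.support)
    (hrep : ∀ x : ℕ → V, IsRay G x → ∃ y : ℕ → V, IsRay T y ∧ RayEquiv G x y)
    {h t : Sym2 V → ZMod 2} (hh : SupportedOn G h)
    (hdiv : ∀ v, cutValue h (Pi.single v 1) = 0) (ht : SupportedOn T t)
    (hcut : ∀ e ∈ T.edgeSet, ∃ ψ φ : V → ZMod 2,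
      (∀ e' ∈ T.edgeSet, cob ψ e' = if e' = e then 1 else 0) ∧ FiniteCob G φ ∧
      {v ∈ T.support | φ v ≠ ψ v}.Finite ∧ t e = cutValue h φ)
    {φ : V → ZMod 2} (hφ : FiniteCob G φ) : cutValue h φ = cutValue t φ := by
  choose! ψ' φ' hψ' hφ' hfin' ht' using hcut
  have hφT : FiniteCob T φ := hφ.mono hle
  let S : Finset (Sym2 V) := Set.Finite.toFinset hφT
  have hS : ∀ e, e ∈ S ↔ e ∈ T.edgeSet ∧ cob φ e ≠ 0 := fun e => Set.Finite.mem_toFinset _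
  have hφS : ∀ e ∈ S, FiniteCob G (φ' e) := fun e he => hφ' e ((hS e).1 he).1
  let θ : V → ZMod 2 := φ + ∑ e ∈ S, ψ' e
  have hθ : ∀ e ∈ T.edgeSet, cob θ e = 0 := by
    intro e he
    rw [cob_add, cob_sum, Finset.sum_congr rfl fun e' he' => hψ' e' ((hS e').1 he').1 e he,
      Finset.sum_ite_eq]
    by_cases heS : e ∈ S
    · rw [if_pos heS, zmod_two_eq_one ((hS e).1 heS).2, CharTwo.add_self_eq_zero]
    · rw [if_neg heS, add_zero]
      by_contra hne
      exact heS ((hS e).2 ⟨he, hne⟩)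
  obtain ⟨c, hc⟩ : ∃ c, ∀ v ∈ T.support, θ v = c := by
    by_cases hne : T.support.Nonempty
    · obtain ⟨o, ho⟩ := hne
      refine ⟨θ o, fun v hv => ?_⟩
      obtain ⟨p, -⟩ := hTc v hv o ho
      exact (show ConnAvoiding T ∅ v o from ⟨p, fun _ _ => id⟩).eq_of_forall_adj
        fun u w huw _ _ => CharTwo.add_eq_zero.1 (hθ s(u, w) huw)
    · exact ⟨0, fun v hv => absurd ⟨v, hv⟩ hne⟩
  let χ : V → ZMod 2 := (φ + ∑ e ∈ S, φ' e) + fun _ => c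
  have hsum : FiniteCob G (∑ e ∈ S, φ' e) := FiniteCob.sum S hφS
  have hχ : FiniteCob G χ := (hφ.add hsum).add (finiteCob_const c)
  have hχfin : {v ∈ T.support | χ v ≠ 0}.Finite := by
    refine (S.finite_toSet.biUnion fun e he => hfin' e ((hS e).1 he).1).subset ?_
    rintro v ⟨hv, hne⟩
    by_contra hcon
    simp only [Set.mem_iUnion, not_exists] at hcon
    refine hne ?_
    have heq : ∀ e ∈ S, φ' e v = ψ' e v := fun e he => by
      by_contra h'; exact hcon e he ⟨hv, h'⟩
    have := hc v hv
    simp only [θ, Pi.add_apply, Finset.sum_apply] at this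
    simp only [χ, Pi.add_apply, Finset.sum_apply]
    rw [Finset.sum_congr rfl heq, this, CharTwo.add_self_eq_zero]
  have h0 := cutValue_eq_zero_of_finite hlf hh hdiv
    (finite_support_of_finite_on_support hlf hconn hrep hχ hχfin)
  rw [cutValue_add hh (hφ.add hsum) (finiteCob_const c), cutValue_add hh hφ hsum,
    cutValue_const, add_zero, cutValue_sum hh S hφS] at h0
  rw [CharTwo.add_eq_zero.1 h0]
  symm
  rw [cutValue, finsum_eq_sum_of_support_subset (s := S)]
  · refine Finset.sum_congr rfl fun e he => ?_
    rw [ht' e ((hS e).1 he).1, zmod_two_eq_one ((hS e).1 he).2, mul_one]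
  · exact fun e he => (hS e).2 ⟨ht e (left_ne_zero_of_mul he), right_ne_zero_of_mul he⟩

lemma supportedOn_lift {f : V → V → ZMod 2} (hf : IsChain1Z2 G f) :
    SupportedOn G (Sym2.lift ⟨f, hf.1⟩) := by
  rintro ⟨a, b⟩ hab
  exact hf.2 a b hab

lemma cutValue_lift_single {f : V → V → ZMod 2} (hf : f ∈ Zsuf1Z2 G) (v : V) :
    cutValue (Sym2.lift ⟨f, hf.1.1⟩) (Pi.single v 1) = 0 := by
  rw [cutValue_single hf.1.1 v (by by_contra h; exact (hf.1.2 v v h).ne rfl), hf.2 v]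

end main

/-- for an end-defining tree T, Z^suf_1(X,ℤ₂) is the internal direct
sum of Z^suf_1(T,ℤ₂) and 𝒞(X,ℤ₂). -/
theorem stmt8 (G T : SimpleGraph V) (hulf : ULF G) (hconn : G.Connected)
    (hsub : IsSubtree G T) (hleaf : Leafless T) (hdef : EndDefining G T) :
    (∀ f : V → V → ZMod 2, f ∈ Zsuf1Z2 T → f ∈ CthinZ2 G → f = 0) ∧
    (∀ f ∈ Zsuf1Z2 G, ∃ t ∈ Zsuf1Z2 T, ∃ c ∈ CthinZ2 G, f = t + c) := by
  have hlf : ∀ v, (G.neighborSet v).Finite := fun v => (hulf.choose_spec v).1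
  obtain ⟨hle, hacyc, hne, hTc⟩ := hsub
  have hlfT : ∀ v, (T.neighborSet v).Finite := fun v => (hlf v).subset fun u hu => hle hu
  have hcut : ∀ e ∈ T.edgeSet, ∃ ψ φ : V → ZMod 2,
      (∀ e' ∈ T.edgeSet, cob ψ e' = if e' = e then 1 else 0) ∧ FiniteCob G φ ∧
      {v ∈ T.support | φ v ≠ ψ v}.Finite := by
    intro e he
    obtain ⟨ψ, hψ⟩ := exists_cob_eq_ite hacyc he
    obtain ⟨φ, hφ⟩ := exists_finiteCob_extension hlf hle hTc hne hdef.1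
      (finiteCob_of_cob_eq_ite hψ)
    exact ⟨ψ, φ, hψ, hφ⟩
  constructor
  · intro f hf hfC
    have hsupp := supportedOn_lift hf.1
    suffices hz : ∀ e, Sym2.lift ⟨f, hf.1.1⟩ e = 0 by
      ext a b; exact hz s(a, b)
    intro e
    by_contra he
    have heT := hsupp e he
    obtain ⟨ψ, φ, hψ, hφ, hfin⟩ := hcut e heT
    have h1 := cutValue_eq_of_finite_ne hlfT hsupp (cutValue_lift_single hf)
      (finiteCob_of_cob_eq_ite hψ) hfin
    rw [evenOnCuts_of_mem_CthinZ2 hfC hf.1.1 φ hφ, cutValue, finsum_eq_single _ e,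
      hψ e heT, if_pos rfl, mul_one] at h1
    · exact he h1.symm
    · intro e' hne'
      by_cases h0 : Sym2.lift ⟨f, hf.1.1⟩ e' = 0
      · rw [h0, zero_mul]
      · rw [hψ e' (hsupp e' h0), if_neg hne', mul_zero]
  · intro f hf
    have hsupp := supportedOn_lift hf.1
    choose! ψ φ hψ hφ hfin using hcut
    let h : Sym2 V → ZMod 2 := Sym2.lift ⟨f, hf.1.1⟩
    let t : Sym2 V → ZMod 2 := fun e => if e ∈ T.edgeSet then cutValue h (φ e) else 0
    have ht : SupportedOn T t := fun e he => by
      by_contra hn; exact he (if_neg hn)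
    have htG : SupportedOn G t := fun e he => SimpleGraph.edgeSet_mono hle (ht e he)
    have hval : ∀ χ : V → ZMod 2, FiniteCob G χ → cutValue h χ = cutValue t χ := fun χ hχ =>
      cutValue_eq_cutValue_of_tree hlf hconn hle hTc hdef.2 hsupp (cutValue_lift_single hf) ht
        (fun e he => ⟨ψ e, φ e, hψ e he, hφ e he, hfin e he, if_pos he⟩) hχ
    have hsymm : ∀ u v, t s(u, v) = t s(v, u) := fun u v => congrArg t Sym2.eq_swap
    have : Countable V := countable_of_locallyFinite hlf hconn
    have : Nonempty V := hconn.nonempty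
    have hht : SupportedOn G (h + t) := fun e he => by
      by_contra hn
      have h1 : h e = 0 := by by_contra h0; exact hn (hsupp e h0)
      have h2 : t e = 0 := by by_contra h0; exact hn (htG e h0)
      exact he (by rw [Pi.add_apply, h1, h2, add_zero])
    refine ⟨fun u v => t s(u, v), ⟨⟨hsymm, fun u v huv => ht _ huv⟩, fun v => ?_⟩,
      fun u v => (h + t) s(u, v), mem_CthinZ2_of_evenOnCuts hht fun χ hχ => ?_, ?_⟩
    · have hlift : Sym2.lift ⟨fun u v => t s(u, v), hsymm⟩ = t := by
        ext ⟨a, b⟩; rfl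
      rw [← cutValue_single hsymm v (by by_contra h0; exact (ht _ h0).ne rfl), hlift,
        ← hval _ (finiteCob_of_finite_support hlf ((Set.finite_singleton v).subset
          fun w hw => by_contra fun hne => hw (Pi.single_eq_of_ne hne _))),
        cutValue_lift_single hf v]
    · rw [cutValue_add_left hsupp htG hχ, hval χ hχ, CharTwo.add_self_eq_zero]
    · ext u v
      change f u v = t s(u, v) + (f u v + t s(u, v))
      linear_combination -CharTwo.add_self_eq_zero (t s(u, v))

end UFH
end

section
/- Let X be a connected uniformly locally finite graph. Then there exists a set ℬ of nonzero elements of ℤ₂^{E(X)}, each of which is a finite sum of circuits of X, such that: (i) ℬ is thin, i.e., every edge of X lies in the support of only finitely many elements of ℬ; (ii) ℬ is thin-sum independent, i.e., no nonempty subset of ℬ has pointwise sum zero (all such sums are well defined by (i)); (iii) every element of 𝒞(X,ℤ₂) equals the pointwise sum of some subset of ℬ. In other words, 𝒞(X,ℤ₂) has a thin thin-sum basis. -/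
open scoped Classical

namespace UFH

variable {V : Type}

/-- A connected graph in which every vertex has finitely many neighbors is countable. -/
theorem countable_of_connected_of_finite_neighborSet {V : Type*} {G : SimpleGraph V}
    (hconn : G.Connected) (hfin : ∀ v, (G.neighborSet v).Finite) : Countable V := by
  obtain ⟨v₀⟩ := hconn.nonempty
  have hball : ∀ n : ℕ, {v | ∃ p : G.Walk v v₀, p.length = n}.Countable := by
    intro n
    induction n with
    | zero =>
      refine (Set.countable_singleton v₀).mono ?_
      rintro v ⟨p, hp⟩
      exact SimpleGraph.Walk.eq_of_length_eq_zero hp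
    | succ n ih =>
      refine (ih.biUnion fun v _ => (hfin v).countable).mono ?_
      rintro v ⟨p, hp⟩
      cases p with
      | nil => simp at hp
      | cons h q =>
        exact Set.mem_biUnion (show _ ∈ {v | ∃ p : G.Walk v v₀, p.length = n} from
          ⟨q, by simpa using hp⟩) h.symm
  refine Set.countable_univ_iff.mp ((Set.countable_iUnion hball).mono fun v _ => ?_)
  obtain ⟨p⟩ := hconn.preconnected v v₀
  exact Set.mem_iUnion.mpr ⟨p.length, p, rfl⟩

/-- Given a sequence of coordinates on a vector space over `ZMod 2`, every subspace contains a
thin, thin-sum independent set whose thin sums give all elements of the closure of the subspace: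
choose one vector for each coordinate which is the leading one of some vector of the subspace. -/
theorem exists_thin_thinSum_basis {M : Type*} [AddCommGroup M] [Module (ZMod 2) M]
    (ev : ℕ → M →ₗ[ZMod 2] ZMod 2) (W : Submodule (ZMod 2) M) :
    ∃ B : Set M, (∀ b ∈ B, b ≠ 0 ∧ b ∈ W) ∧ (∀ n, {b ∈ B | ev n b ≠ 0}.Finite) ∧
      (∀ S ⊆ B, S.Nonempty → ∃ n, ∑ᶠ b : ↥S, ev n b.1 ≠ 0) ∧
      ∀ f : M, (∀ n, ∃ w ∈ W, ∀ m ≤ n, ev m w = ev m f) →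
        ∃ S ⊆ B, ∀ n, ev n f = ∑ᶠ b : ↥S, ev n b.1 := by
  set L : Set ℕ := {n | ∃ w ∈ W, ev n w ≠ 0 ∧ ∀ m < n, ev m w = 0} with hL
  have hchoose : ∀ n, ∃ w, n ∈ L → w ∈ W ∧ ev n w ≠ 0 ∧ ∀ m < n, ev m w = 0 := by
    intro n
    by_cases hn : n ∈ L
    · obtain ⟨w, hw⟩ := hn
      exact ⟨w, fun _ => hw⟩
    · exact ⟨0, fun h => absurd h hn⟩
  choose b hb using hchoose
  have hinj : Set.InjOn b L := by
    intro m hm n hn hmn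
    by_contra hne
    rcases lt_or_gt_of_ne hne with h | h
    · exact (hb m hm).2.1 (hmn ▸ (hb n hn).2.2 m h)
    · exact (hb n hn).2.1 (hmn ▸ (hb m hm).2.2 n h)
  have hle : ∀ {m n}, m ∈ L → ev n (b m) ≠ 0 → m ≤ n := fun hm h =>
    not_lt.mp fun hlt => h ((hb _ hm).2.2 _ hlt)
  refine ⟨b '' L, ?_, ?_, ?_, ?_⟩
  · rintro _ ⟨n, hn, rfl⟩
    exact ⟨fun h => (hb n hn).2.1 (by rw [h, map_zero]), (hb n hn).1⟩
  · intro k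
    refine ((Set.finite_Iic k).image b).subset ?_
    rintro _ ⟨⟨n, hn, rfl⟩, hne⟩
    exact ⟨n, hle hn hne, rfl⟩
  · intro S hS hne
    have hex : ∃ n, n ∈ L ∧ b n ∈ S := by
      obtain ⟨s, hs⟩ := hne
      obtain ⟨n, hn, rfl⟩ := hS hs
      exact ⟨n, hn, hs⟩
    obtain ⟨hn, hs⟩ := Nat.find_spec hex
    refine ⟨Nat.find hex, ?_⟩
    rw [finsum_eq_single (fun s : ↥S => ev (Nat.find hex) s.1) ⟨_, hs⟩]
    · exact (hb _ hn).2.1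
    · rintro ⟨s, hsS⟩ hsne
      obtain ⟨m, hm, rfl⟩ := hS hsS
      by_contra h
      have heq : m = Nat.find hex := le_antisymm (hle hm h) (Nat.find_min' hex ⟨hm, hsS⟩)
      exact hsne (Subtype.ext (congrArg b heq))
  · intro f hf
    let r : ℕ → M := fun n =>
      Nat.rec f (fun n x => if ev n x ≠ 0 then x - b n else x) n
    have hr : ∀ n, r (n + 1) = if ev n (r n) ≠ 0 then r n - b n else r n := fun _ => rfl
    have hlead : ∀ n, (∀ k, ∃ w ∈ W, ∀ m ≤ k, ev m w = ev m (r n)) →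
        (∀ m < n, ev m (r n) = 0) → ev n (r n) ≠ 0 → n ∈ L := by
      intro n hcl hz hne
      obtain ⟨w, hw, hwe⟩ := hcl n
      exact ⟨w, hw, by rwa [hwe n le_rfl], fun m hm => by rw [hwe m hm.le, hz m hm]⟩
    have hinv : ∀ n, (∀ k, ∃ w ∈ W, ∀ m ≤ k, ev m w = ev m (r n)) ∧
        ∀ m < n, ev m (r n) = 0 := by
      intro n
      induction n with
      | zero => exact ⟨hf, fun m hm => absurd hm (Nat.not_lt_zero m)⟩
      | succ n ih =>
        obtain ⟨hcl, hz⟩ := ih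
        rw [hr]
        split_ifs with hne
        · have hn := hlead n hcl hz hne
          refine ⟨fun k => ?_, fun m hm => ?_⟩
          · obtain ⟨w, hw, hwe⟩ := hcl k
            exact ⟨w - b n, W.sub_mem hw (hb n hn).1, fun m hm => by
              rw [map_sub, map_sub, hwe m hm]⟩
          · rw [map_sub]
            rcases Nat.lt_succ_iff_lt_or_eq.mp hm with h | rfl
            · rw [hz m h, (hb n hn).2.2 m h, sub_zero]
            · have hxy : ∀ x y : ZMod 2, x ≠ 0 → y ≠ 0 → x - y = 0 := by decide
              exact hxy _ _ hne (hb _ hn).2.1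
        · refine ⟨hcl, fun m hm => ?_⟩
          rcases Nat.lt_succ_iff_lt_or_eq.mp hm with h | rfl
          · exact hz m h
          · exact not_not.mp hne
    set T : Set ℕ := {n | ev n (r n) ≠ 0} with hT
    have hTL : T ⊆ L := fun n hn => hlead n (hinv n).1 (hinv n).2 hn
    have hsum : ∀ n, f = r n + ∑ m ∈ (Finset.range n).filter (· ∈ T), b m := by
      intro n
      induction n with
      | zero => simp [r]
      | succ n ih =>
        rw [Finset.range_add_one, Finset.filter_insert, hr]
        by_cases hne : ev n (r n) ≠ 0
        · rw [if_pos hne, if_pos (show n ∈ T from hne), Finset.sum_insert (by simp)]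
          rw [← add_assoc, sub_add_cancel]
          exact ih
        · rw [if_neg hne, if_neg (show n ∉ T from hne)]
          exact ih
    refine ⟨b '' T, Set.image_mono hTL, fun k => ?_⟩
    rw [finsum_set_coe_eq_finsum_mem (b '' T) (f := fun x => ev k x),
      finsum_mem_image (hinj.mono hTL)]
    conv_lhs => rw [hsum (k + 1)]
    rw [map_add, (hinv (k + 1)).2 k k.lt_succ_self, zero_add, map_sum, finsum_mem_def,
      finsum_eq_sum_of_support_subset (s := (Finset.range (k + 1)).filter (· ∈ T))]
    · refine Finset.sum_congr rfl fun m hm => ?_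
      rw [Set.indicator_of_mem (Finset.mem_filter.mp hm).2]
    · intro m hm
      have hmT : m ∈ T := Set.mem_of_indicator_ne_zero hm
      have hne : ev k (b m) ≠ 0 := by
        simpa only [Function.mem_support, Set.indicator_of_mem hmT] using hm
      simpa [hmT] using Nat.lt_succ_of_le (hle (hTL hmT) hne)

theorem onWalk_of_traversals_ne_zero {G : SimpleGraph V} {u v : V} {p : G.Walk u v} {a b : V}
    (h : traversals p a b ≠ 0) : OnWalk p a b := by
  obtain ⟨i, hi⟩ := Finset.card_ne_zero.mp h
  obtain ⟨hi, hab⟩ := Finset.mem_filter.mp hi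
  exact ⟨i, Finset.mem_range.mp hi, Or.inl hab⟩

theorem onWalk_of_walkChainZ2_ne_zero {G : SimpleGraph V} {u v : V} {p : G.Walk u v} {a b : V}
    (h : walkChainZ2 p a b ≠ 0) : OnWalk p a b := by
  by_cases hab : traversals p a b = 0
  · have hba : traversals p b a ≠ 0 := fun hba => h (by simp [walkChainZ2, hab, hba])
    obtain ⟨i, hi, hi'⟩ := onWalk_of_traversals_ne_zero hba
    exact ⟨i, hi, hi'.symm⟩
  · exact onWalk_of_traversals_ne_zero hab

/-- The finite sums of circuits of `G`. -/
noncomputable def finiteCircuitSums (G : SimpleGraph V) :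
    Submodule (ZMod 2) (V → V → ZMod 2) :=
  Submodule.span (ZMod 2) (Set.range fun c : Circuit G => walkChainZ2 c.2)

theorem exists_finite_circSumZ2_of_mem {G : SimpleGraph V} {f : V → V → ZMod 2}
    (hf : f ∈ finiteCircuitSums G) :
    ∃ g : Circuit G → ZMod 2, {c | g c ≠ 0}.Finite ∧ f = circSumZ2 G g := by
  obtain ⟨g, rfl⟩ := Finsupp.mem_span_range_iff_exists_finsupp.mp hf
  refine ⟨g, g.hasFiniteSupport, ?_⟩
  funext a b
  rw [circSumZ2, finsum_eq_sum_of_support_subset (s := g.support)]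
  · simp [Finsupp.sum, Finset.sum_apply]
  · intro c hc
    exact Finsupp.mem_support_iff.mpr (left_ne_zero_of_mul hc)

/-- On any finite set of edges, a thin sum of circuits agrees with a finite one. -/
theorem exists_finiteCircuitSum_eqOn {G : SimpleGraph V} {f : V → V → ZMod 2}
    (hf : f ∈ CthinZ2 G) {s : Set (V × V)} (hs : s.Finite) :
    ∃ w ∈ finiteCircuitSums G, ∀ e ∈ s, w e.1 e.2 = f e.1 e.2 := by
  obtain ⟨g, hg, rfl⟩ := hf
  have hU : (⋃ e ∈ s, {c : Circuit G | g c ≠ 0 ∧ OnWalk c.2 e.1 e.2}).Finite :=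
    hs.biUnion fun e _ => hg e.1 e.2
  refine ⟨∑ c ∈ hU.toFinset, g c • walkChainZ2 c.2, Submodule.sum_mem _ fun c _ =>
    Submodule.smul_mem _ _ (Submodule.subset_span ⟨c, rfl⟩), fun e he => ?_⟩
  rw [circSumZ2, finsum_eq_sum_of_support_subset (s := hU.toFinset)]
  · simp [Finset.sum_apply]
  · intro c hc
    rw [Set.Finite.coe_toFinset]
    exact Set.mem_biUnion he
      ⟨left_ne_zero_of_mul hc, onWalk_of_walkChainZ2_ne_zero (right_ne_zero_of_mul hc)⟩

/-- 𝒞(X,ℤ₂) has a thin thin-sum basis consisting of finite sums of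
circuits. -/
theorem stmt9 (G : SimpleGraph V) (hulf : ULF G) (hconn : G.Connected) :
    ∃ B : Set (V → V → ZMod 2),
      (∀ b ∈ B, b ≠ 0 ∧ ∃ g : Circuit G → ZMod 2, {c | g c ≠ 0}.Finite ∧ b = circSumZ2 G g) ∧
      (∀ u v : V, {b ∈ B | b u v ≠ 0}.Finite) ∧
      (∀ S ⊆ B, S.Nonempty → ¬ (fun u v => ∑ᶠ b : ↥S, b.1 u v) = 0) ∧
      (∀ f ∈ CthinZ2 G, ∃ S ⊆ B, f = fun u v => ∑ᶠ b : ↥S, b.1 u v) := by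
  obtain ⟨D, hD⟩ := hulf
  have : Countable V := countable_of_connected_of_finite_neighborSet hconn fun v => (hD v).1
  have : Nonempty V := hconn.nonempty
  obtain ⟨φ, hφ⟩ := exists_surjective_nat (V × V)
  let ev : ℕ → (V → V → ZMod 2) →ₗ[ZMod 2] ZMod 2 := fun n =>
    LinearMap.proj (φ n).2 ∘ₗ LinearMap.proj (φ n).1
  obtain ⟨B, hB, hthin, hind, hspan⟩ := exists_thin_thinSum_basis ev (finiteCircuitSums G)
  refine ⟨B, fun b hb => ⟨(hB b hb).1, exists_finite_circSumZ2_of_mem (hB b hb).2⟩, ?_, ?_, ?_⟩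
  · intro u v
    obtain ⟨n, hn⟩ := hφ (u, v)
    simpa [ev, hn] using hthin n
  · intro S hS hne h0
    obtain ⟨n, hn⟩ := hind S hS hne
    exact hn (congrFun (congrFun h0 (φ n).1) (φ n).2)
  · intro f hf
    obtain ⟨S, hS, hfS⟩ := hspan f fun n => by
      obtain ⟨w, hw, hwf⟩ := exists_finiteCircuitSum_eqOn hf ((Set.finite_Iic n).image φ)
      exact ⟨w, hw, fun m hm => hwf _ ⟨m, hm, rfl⟩⟩
    refine ⟨S, hS, ?_⟩
    funext u v
    obtain ⟨n, hn⟩ := hφ (u, v)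
    simpa [ev, hn] using hfS n

end UFH
end

section
/- Let Y be a countable set, let W ⊆ ℤ₂^Y be a thin-sum space, and let V_0 ⊆ V_1 ⊆ V_2 ⊆ … be an increasing sequence of thin-sum subspaces of W. If W admits a countable thin thin-sum basis, then there exist a countable thin thin-sum basis ℬ for W and nested subsets ℬ_0 ⊆ ℬ_1 ⊆ ⋯ ⊆ ℬ such that each ℬ_i is a thin-sum basis for V_i. -/
open scoped Classical

namespace UFH

variable {V : Type}

/-- `y` is the first point, in the order given by `e`, at which `f` does not vanish. -/
def IsLead {Y : Type} (e : Y → ℕ) (f : Y → ZMod 2) (y : Y) : Prop :=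
  f y ≠ 0 ∧ ∀ z, e z < e y → f z = 0

/-- The points that are leading for some element of `U`. -/
def leadSet {Y : Type} (e : Y → ℕ) (U : Set (Y → ZMod 2)) : Set Y :=
  {y | ∃ f ∈ U, IsLead e f y}

theorem zmod2_eq_one {a : ZMod 2} (h : a ≠ 0) : a = 1 := by
  revert a; decide

theorem thinSum_apply {Y : Type} (F : Set (Y → ZMod 2)) (y : Y) :
    thinSum F y = ∑ᶠ f ∈ F, f y :=
  finsum_set_coe_eq_finsum_mem (f := fun f : Y → ZMod 2 => f y) F

theorem exists_isLead {Y : Type} (e : Y → ℕ) {f : Y → ZMod 2} (hf : f ≠ 0) :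
    ∃ y, IsLead e f y := by
  obtain ⟨y₀, hy₀⟩ := Function.ne_iff.mp hf
  obtain ⟨y, hy, hmin⟩ := (InvImage.wf e Nat.lt_wfRel.wf).has_min {y | f y ≠ 0} ⟨y₀, hy₀⟩
  exact ⟨y, hy, fun z hz => by_contra fun h => hmin z h hz⟩

theorem leadSet_mono {Y : Type} (e : Y → ℕ) {U U' : Set (Y → ZMod 2)} (h : U ⊆ U') :
    leadSet e U ⊆ leadSet e U' :=
  fun _ ⟨f, hf, hy⟩ => ⟨f, h hf, hy⟩

section Echelon

variable {Y : Type} {e : Y → ℕ} {b : Y → Y → ZMod 2} {S : Set Y}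

theorem injOn_of_isLead (he : e.Injective) (hb : ∀ y ∈ S, IsLead e (b y) y) :
    Set.InjOn b S := by
  intro y hy z hz hyz
  rcases lt_trichotomy (e y) (e z) with h | h | h
  · exact absurd (hyz ▸ (hb z hz).2 y h) (hb y hy).1
  · exact he h
  · exact absurd (hyz ▸ (hb y hy).2 z h) (hb z hz).1

theorem thinFamily_of_isLead (he : e.Injective) (hb : ∀ y ∈ S, IsLead e (b y) y) :
    ThinFamily (b '' S) := by
  intro y
  refine (((Set.finite_Iic (e y)).preimage he.injOn).image b).subset ?_
  rintro _ ⟨⟨z, hz, rfl⟩, hne⟩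
  exact ⟨z, not_lt.mp fun h => hne ((hb z hz).2 y h), rfl⟩

/-- Coefficients found by forward substitution in the echelon family `b`, expanding `f`. -/
noncomputable def echelonCoeff {Y : Type} (e : Y → ℕ) (b : Y → Y → ZMod 2) (S : Set Y)
    (f : Y → ZMod 2) (y : Y) : ZMod 2 :=
  if y ∈ S then f y + ∑ᶠ z : {z // e z < e y}, echelonCoeff e b S f z.1 * b z.1 y else 0
termination_by e y
decreasing_by exact z.2

theorem thinSum_image_of_isLead (he : e.Injective) (hb : ∀ y ∈ S, IsLead e (b y) y)
    {T : Set Y} (hT : T ⊆ S) {y : Y} {c : Y → ZMod 2} (hc : ∀ z, z ∈ T ↔ c z ≠ 0)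
    (hy : y ∈ S) :
    thinSum (b '' T) y = c y + ∑ᶠ z ∈ {z | e z < e y}, c z * b z y := by
  have hfin : {z | e z < e y}.Finite := (Set.finite_Iio (e y)).preimage he.injOn
  have hone : c y = c y * b y y := by rw [zmod2_eq_one (hb y hy).1, mul_one]
  rw [thinSum_apply, finsum_mem_image ((injOn_of_isLead he hb).mono hT), hone,
    ← finsum_mem_insert (fun z => c z * b z y) (by simp) hfin]
  refine finsum_congr fun z => ?_
  by_cases hz : z ∈ T
  · have hcz : c z = 1 := zmod2_eq_one ((hc z).mp hz)
    by_cases hzy : z ∈ insert y {z | e z < e y}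
    · rw [finsum_eq_if, finsum_eq_if, if_pos hz, if_pos hzy, hcz, one_mul]
    · have hlt : e y < e z := by
        simp only [Set.mem_insert_iff, Set.mem_ofPred_eq, not_or, not_lt] at hzy
        exact lt_of_le_of_ne hzy.2 fun h => hzy.1 (he h.symm)
      rw [finsum_eq_if, finsum_eq_if, if_neg hzy, (hb z (hT hz)).2 y hlt, ite_self]
  · have hcz : c z = 0 := not_not.mp fun h => hz ((hc z).mpr h)
    rw [finsum_eq_if, finsum_eq_if, if_neg hz, hcz, zero_mul, ite_self]

theorem exists_thinSum_eq_of_isLead {U : Set (Y → ZMod 2)} (hU : IsThinSumSpace U)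
    (he : e.Injective) (hbU : ∀ y ∈ leadSet e U, b y ∈ U)
    (hb : ∀ y ∈ leadSet e U, IsLead e (b y) y) {f : Y → ZMod 2} (hf : f ∈ U) :
    ∃ T ⊆ leadSet e U, f = thinSum (b '' T) := by
  set c := echelonCoeff e b (leadSet e U) f with hcdef
  have hT : {z | c z ≠ 0} ⊆ leadSet e U := by
    intro z hz
    by_contra h
    exact hz (by rw [hcdef, echelonCoeff, if_neg h])
  refine ⟨{z | c z ≠ 0}, hT, ?_⟩
  by_contra hne
  have hsum : thinSum (b '' {z | c z ≠ 0}) ∈ U := by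
    refine hU.2.2 _ ?_ (thinFamily_of_isLead he fun y hy => hb y (hT hy))
    rintro _ ⟨z, hz, rfl⟩
    exact hbU z (hT hz)
  have hne' : f + thinSum (b '' {z | c z ≠ 0}) ≠ 0 := fun h =>
    hne (funext fun y => CharTwo.add_eq_zero.mp (congrFun h y))
  obtain ⟨y, hy⟩ := exists_isLead e hne'
  have hyS : y ∈ leadSet e U := ⟨_, hU.2.1 f hf _ hsum, hy⟩
  have hcy : c y = f y + ∑ᶠ z ∈ {z | e z < e y}, c z * b z y := by
    rw [← finsum_set_coe_eq_finsum_mem (f := fun z => c z * b z y), hcdef, echelonCoeff,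
      if_pos hyS]
    rfl
  apply hy.1
  rw [Pi.add_apply, thinSum_image_of_isLead he hb hT (fun _ => Iff.rfl) hyS, hcy, add_assoc,
    CharTwo.add_self_eq_zero, add_zero, CharTwo.add_self_eq_zero]

theorem thinSum_ne_zero_of_isLead (he : e.Injective) (hb : ∀ y ∈ S, IsLead e (b y) y)
    {T : Set Y} (hT : T ⊆ S) (hne : T.Nonempty) : thinSum (b '' T) ≠ 0 := by
  obtain ⟨y, hy, hmin⟩ := (InvImage.wf e Nat.lt_wfRel.wf).has_min T hne
  refine Function.ne_iff.mpr ⟨y, ?_⟩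
  rw [thinSum_image_of_isLead he hb hT (c := T.indicator 1) (by simp) (hT hy),
    finsum_mem_eq_zero_of_forall_eq_zero, Set.indicator_of_mem hy]
  · simp
  · intro z hz
    rw [Set.indicator_of_notMem fun h => hmin z h hz, zero_mul]

theorem isThinSumBasis_of_isLead {U : Set (Y → ZMod 2)} (hU : IsThinSumSpace U)
    (he : e.Injective) (hbU : ∀ y ∈ leadSet e U, b y ∈ U)
    (hb : ∀ y ∈ leadSet e U, IsLead e (b y) y) :
    IsThinSumBasis (b '' leadSet e U) U := by
  refine ⟨Set.image_subset_iff.mpr hbU, fun f hf => ?_, fun F hF _ hne => ?_⟩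
  · obtain ⟨T, hT, rfl⟩ := exists_thinSum_eq_of_isLead hU he hbU hb hf
    exact ⟨_, Set.image_mono hT, thinFamily_of_isLead he fun y hy => hb y (hT hy), rfl⟩
  · obtain ⟨T, hT, rfl⟩ := Set.subset_image_iff.mp hF
    exact thinSum_ne_zero_of_isLead he hb hT hne.of_image

end Echelon

/-- Leading elements can be chosen in the smallest possible member of an increasing sequence. -/
theorem exists_isLead_filtered {Y : Type} (e : Y → ℕ) {W : Set (Y → ZMod 2)}
    {Vs : ℕ → Set (Y → ZMod 2)} (hVW : ∀ i, Vs i ⊆ W) (hmono : Monotone Vs) (y : Y) :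
    ∃ g : Y → ZMod 2, (y ∈ leadSet e W → g ∈ W ∧ IsLead e g y) ∧
      ∀ i, y ∈ leadSet e (Vs i) → g ∈ Vs i := by
  by_cases h : ∃ i, y ∈ leadSet e (Vs i)
  · obtain ⟨g, hg, hy⟩ := Nat.find_spec h
    exact ⟨g, fun _ => ⟨hVW _ hg, hy⟩, fun i hi => hmono (Nat.find_min' h hi) hg⟩
  · by_cases hW : y ∈ leadSet e W
    · obtain ⟨g, hg⟩ := hW
      exact ⟨g, fun _ => hg, fun i hi => absurd ⟨i, hi⟩ h⟩
    · exact ⟨0, fun h' => absurd h' hW, fun i hi => absurd ⟨i, hi⟩ h⟩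

/-- filtered thin bases for a thin-sum space with a countable thin
basis and an increasing sequence of thin-sum subspaces. -/
theorem stmt10 {Y : Type} [Countable Y] (W : Set (Y → ZMod 2)) (hW : IsThinSumSpace W)
    (Vs : ℕ → Set (Y → ZMod 2)) (hVs : ∀ i, IsThinSumSpace (Vs i))
    (hVW : ∀ i, Vs i ⊆ W) (hmono : ∀ i, Vs i ⊆ Vs (i + 1))
    (hbasis : ∃ A : Set (Y → ZMod 2), A.Countable ∧ ThinFamily A ∧ IsThinSumBasis A W) :
    ∃ B : Set (Y → ZMod 2), B.Countable ∧ ThinFamily B ∧ IsThinSumBasis B W ∧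
      ∃ Bs : ℕ → Set (Y → ZMod 2), (∀ i, Bs i ⊆ Bs (i + 1)) ∧ (∀ i, Bs i ⊆ B) ∧
        ∀ i, IsThinSumBasis (Bs i) (Vs i) := by
  obtain ⟨e, he⟩ := exists_injective_nat Y
  choose b hbW hbV using exists_isLead_filtered e hVW (monotone_nat_of_le_succ hmono)
  have hlead : ∀ y ∈ leadSet e W, IsLead e (b y) y := fun y hy => (hbW y hy).2
  refine ⟨b '' leadSet e W, (Set.to_countable _).image b, thinFamily_of_isLead he hlead,
    isThinSumBasis_of_isLead hW he (fun y hy => (hbW y hy).1) hlead,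
    fun i => b '' leadSet e (Vs i), fun i => Set.image_mono (leadSet_mono e (hmono i)),
    fun i => Set.image_mono (leadSet_mono e (hVW i)), fun i => ?_⟩
  exact isThinSumBasis_of_isLead (hVs i) he (fun y hy => hbV y i hy)
    fun y hy => hlead y (leadSet_mono e (hVW i) hy)

end UFH
end
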